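/- arXiv:0903.4310 — 3 statements merged into one kernel-verified Lean document; each statement's English description precedes it below -/
import Mathlib

section
/- Let k be a field, M an affine semigroup in ℤ^n, and F, G two faces of M. Let T_F be the multiplicative subset {t^a : a ∈ F} of k[M] (whose image in k[M]/p_G is again a multiplicative set). If F ⊄ G, then the localization T_F^{-1}(k[M]/p_G) is the zero ring. If F ⊆ G, then G − F := {a − b : a ∈ G, b ∈ F} is an additive submonoid of ℤ^n and T_F^{-1}(k[M]/p_G) is isomorphic as a k-algebra to the semigroup ring k[G − F]. -/
/-- `F` is a face of the affine semigroup `M ⊆ ℤⁿ`. -/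
def IsFace {n : ℕ} (M F : AddSubmonoid (Fin n → ℤ)) : Prop :=
  F ≤ M ∧ ∀ a ∈ M, ∀ b ∈ M, a + b ∈ F → a ∈ F ∧ b ∈ F

/-- The ideal `p_F` of `k[M]` generated by the monomials `t^a` with `a ∈ M \ F`. -/
noncomputable def facePrime (k : Type*) [Field k] {n : ℕ} (M F : AddSubmonoid (Fin n → ℤ)) :
    Ideal (AddMonoidAlgebra k M) :=
  Ideal.span {x | ∃ a : M, (a : Fin n → ℤ) ∉ F ∧ x = AddMonoidAlgebra.of' k M a}

/-- The multiplicative set `T_F = {t^a : a ∈ F}` of monomials of `k[M]` with exponent in `F`. -/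
noncomputable def faceMonomials (k : Type*) [Field k] {n : ℕ}
    (M F : AddSubmonoid (Fin n → ℤ)) : Submonoid (AddMonoidAlgebra k M) where
  carrier := {x | ∃ a : M, (a : Fin n → ℤ) ∈ F ∧ x = AddMonoidAlgebra.of' k M a}
  one_mem' := ⟨0, by simpa using F.zero_mem, by
    simp [AddMonoidAlgebra.of'_apply, AddMonoidAlgebra.one_def]⟩
  mul_mem' := by
    rintro x y ⟨a, ha, rfl⟩ ⟨b, hb, rfl⟩
    exact ⟨a + b, by push_cast; exact F.add_mem ha hb, by
      simp [AddMonoidAlgebra.of'_apply, AddMonoidAlgebra.single_mul_single]⟩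

/-- The image of `T_F` in `k[M]/p_G`, again a multiplicative set. -/
noncomputable def faceMonomialsBar (k : Type*) [Field k] {n : ℕ}
    (M F G : AddSubmonoid (Fin n → ℤ)) :
    Submonoid (AddMonoidAlgebra k M ⧸ facePrime k M G) :=
  (faceMonomials k M F).map (Ideal.Quotient.mk (facePrime k M G))

namespace AffineSemigroup

variable {k : Type*} [Field k] {n : ℕ} {M F G : AddSubmonoid (Fin n → ℤ)}

/-- The submonoid `G - F` of `ℤⁿ` of differences of elements of `G` and `F`. -/
def differenceSubmonoid (G F : AddSubmonoid (Fin n → ℤ)) : AddSubmonoid (Fin n → ℤ) where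
  carrier := {c | ∃ a ∈ G, ∃ b ∈ F, c = a - b}
  zero_mem' := ⟨0, G.zero_mem, 0, F.zero_mem, by simp⟩
  add_mem' := by
    rintro _ _ ⟨a, ha, b, hb, rfl⟩ ⟨a', ha', b', hb', rfl⟩
    exact ⟨a + a', G.add_mem ha ha', b + b', F.add_mem hb hb', by abel⟩

theorem le_differenceSubmonoid : G ≤ differenceSubmonoid G F :=
  fun a ha => ⟨a, ha, 0, F.zero_mem, by simp⟩

theorem neg_mem_differenceSubmonoid {b : Fin n → ℤ} (hb : b ∈ F) :
    -b ∈ differenceSubmonoid G F :=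
  ⟨0, G.zero_mem, b, hb, by simp⟩

section Localization

variable (k M F G)

/-- The monomial `t^a`, as an element of `T_F⁻¹(k[M]/p_G)`. -/
noncomputable def localizedMonomial :
    Multiplicative M →* Localization (faceMonomialsBar k M F G) :=
  ((algebraMap (AddMonoidAlgebra k M ⧸ facePrime k M G)
    (Localization (faceMonomialsBar k M F G))).comp
      (Ideal.Quotient.mk (facePrime k M G))).toMonoidHom.comp (AddMonoidAlgebra.of k M)

variable {k M F G}

theorem mk_single_eq_zero {a : M} (ha : (a : Fin n → ℤ) ∉ G) :
    Ideal.Quotient.mk (facePrime k M G) (AddMonoidAlgebra.single a 1) = 0 :=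
  Ideal.Quotient.eq_zero_iff_mem.mpr (Ideal.subset_span ⟨a, ha, rfl⟩)

theorem localizedMonomial_eq_zero {a : M} (ha : (a : Fin n → ℤ) ∉ G) :
    localizedMonomial k M F G (.ofAdd a) = 0 :=
  (congrArg (algebraMap _ (Localization (faceMonomialsBar k M F G)))
    (mk_single_eq_zero (k := k) ha)).trans (map_zero _)

theorem isUnit_localizedMonomial {a : M} (ha : (a : Fin n → ℤ) ∈ F) :
    IsUnit (localizedMonomial k M F G (.ofAdd a)) :=
  IsLocalization.map_units (Localization (faceMonomialsBar k M F G))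
    (⟨Ideal.Quotient.mk _ (AddMonoidAlgebra.of' k M a), _, ⟨a, ha, rfl⟩, rfl⟩ :
      faceMonomialsBar k M F G)

theorem subsingleton_localization_of_not_le (hF : F ≤ M) (h : ¬ F ≤ G) :
    Subsingleton (Localization (faceMonomialsBar k M F G)) := by
  obtain ⟨a, haF, haG⟩ := SetLike.not_le_iff_exists.mp h
  have hu := isUnit_localizedMonomial (k := k) (M := M) (G := G) (a := ⟨a, hF haF⟩) haF
  rw [localizedMonomial_eq_zero haG] at hu
  exact isUnit_zero_iff.mp hu |> subsingleton_of_zero_eq_one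

theorem exists_localized_quotient (hF : F ≤ M) (hG : G ≤ M)
    (c : differenceSubmonoid G F) :
    ∃ x : Localization (faceMonomialsBar k M F G), ∀ a b : M, (a : Fin n → ℤ) ∈ G →
      (b : Fin n → ℤ) ∈ F → (c : Fin n → ℤ) = a - b →
      x * localizedMonomial k M F G (.ofAdd b) = localizedMonomial k M F G (.ofAdd a) := by
  obtain ⟨c, a₀, ha₀, b₀, hb₀, rfl⟩ := c
  have hu := isUnit_localizedMonomial (k := k) (M := M) (G := G) (a := ⟨b₀, hF hb₀⟩) hb₀
  obtain ⟨y, hy⟩ := hu.exists_left_inv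
  refine ⟨localizedMonomial k M F G (.ofAdd ⟨a₀, hG ha₀⟩) * y, fun a b ha hb hab => ?_⟩
  have hsum : (⟨a₀, hG ha₀⟩ : M) + b = a + ⟨b₀, hF hb₀⟩ :=
    Subtype.ext (sub_eq_sub_iff_add_eq_add.mp hab)
  have hmul := congrArg (fun m => localizedMonomial k M F G (.ofAdd m)) hsum
  simp only [ofAdd_add, map_mul] at hmul
  linear_combination y * hmul + localizedMonomial k M F G (.ofAdd a) * hy

/-- There is an algebra map `k[G - F] → T_F⁻¹(k[M]/p_G)` sending `t^(a - b)` to `t^a / t^b`. -/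
theorem exists_algHom_to_localization (hF : F ≤ M) (hG : G ≤ M) :
    ∃ φ : AddMonoidAlgebra k (differenceSubmonoid G F) →ₐ[k]
        Localization (faceMonomialsBar k M F G),
      ∀ (c : differenceSubmonoid G F) (a b : M), (a : Fin n → ℤ) ∈ G →
        (b : Fin n → ℤ) ∈ F → (c : Fin n → ℤ) = a - b →
        φ (.single c 1) * localizedMonomial k M F G (.ofAdd b) =
          localizedMonomial k M F G (.ofAdd a) := by
  choose f hf using exists_localized_quotient (k := k) hF hG
  let g : Multiplicative (differenceSubmonoid G F) →*
      Localization (faceMonomialsBar k M F G) :=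
    { toFun := fun c => f c.toAdd
      map_one' := by
        simpa [ofAdd_zero] using hf 0 0 0 G.zero_mem F.zero_mem (by simp)
      map_mul' := by
        intro c d
        obtain ⟨a, ha, b, hb, hab⟩ := c.toAdd.2
        obtain ⟨a', ha', b', hb', hab'⟩ := d.toAdd.2
        have hc := hf c.toAdd ⟨a, hG ha⟩ ⟨b, hF hb⟩ ha hb hab
        have hd := hf d.toAdd ⟨a', hG ha'⟩ ⟨b', hF hb'⟩ ha' hb' hab'
        have hcd := hf (c * d).toAdd (⟨a, hG ha⟩ + ⟨a', hG ha'⟩) (⟨b, hF hb⟩ + ⟨b', hF hb'⟩)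
          (G.add_mem ha ha') (F.add_mem hb hb') (by
            rw [toAdd_mul, AddSubmonoid.coe_add, hab, hab']
            exact sub_add_sub_comm a b a' b')
        simp only [ofAdd_add, map_mul] at hcd
        refine ((isUnit_localizedMonomial (a := ⟨b, hF hb⟩) hb).mul
          (isUnit_localizedMonomial (a := ⟨b', hF hb'⟩) hb')).mul_right_cancel ?_
        linear_combination hcd - localizedMonomial k M F G (.ofAdd ⟨a', hG ha'⟩) * hc -
          f c.toAdd * localizedMonomial k M F G (.ofAdd ⟨b, hF hb⟩) * hd }
  refine ⟨AddMonoidAlgebra.lift k _ _ g, fun c a b ha hb hab => ?_⟩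
  rw [AddMonoidAlgebra.lift_single, one_smul]
  exact hf c a b ha hb hab

/-- There is an algebra map `T_F⁻¹(k[M]/p_G) → k[G - F]` sending `t^a` to itself for `a ∈ G`. -/
theorem exists_algHom_from_localization (hG : IsFace M G) (hFG : F ≤ G) :
    ∃ ψ : Localization (faceMonomialsBar k M F G) →ₐ[k]
        AddMonoidAlgebra k (differenceSubmonoid G F),
      ∀ (a : M) (ha : (a : Fin n → ℤ) ∈ G),
        ψ (localizedMonomial k M F G (.ofAdd a)) =
          .single ⟨a, le_differenceSubmonoid ha⟩ 1 := by
  classical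
  let g : Multiplicative M →* AddMonoidAlgebra k (differenceSubmonoid G F) :=
    { toFun := fun a => if ha : (a.toAdd : Fin n → ℤ) ∈ G then
        .single ⟨a.toAdd, le_differenceSubmonoid ha⟩ 1 else 0
      map_one' := by
        rw [dif_pos (by simp [G.zero_mem])]
        rfl
      map_mul' := by
        intro a b
        by_cases hab : (a.toAdd : Fin n → ℤ) ∈ G ∧ (b.toAdd : Fin n → ℤ) ∈ G
        · rw [dif_pos hab.1, dif_pos hab.2,
            dif_pos (show ((a * b).toAdd : Fin n → ℤ) ∈ G from G.add_mem hab.1 hab.2),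
            AddMonoidAlgebra.single_mul_single, one_mul]
          rfl
        · rw [dif_neg (show ((a * b).toAdd : Fin n → ℤ) ∉ G from
            fun h => hab (hG.2 _ a.toAdd.2 _ b.toAdd.2 h))]
          rcases not_and_or.mp hab with h | h
          · rw [dif_neg h, zero_mul]
          · rw [dif_neg h, mul_zero] }
  have hg : ∀ (a : M) (ha : (a : Fin n → ℤ) ∈ G),
      g (.ofAdd a) = .single ⟨a, le_differenceSubmonoid ha⟩ 1 := fun a ha => dif_pos ha
  let e := AddMonoidAlgebra.lift k (AddMonoidAlgebra k (differenceSubmonoid G F)) M g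
  have he : ∀ a : M, e (.single a 1) = g (.ofAdd a) := fun a => by
    simp only [e, AddMonoidAlgebra.lift_single, one_smul]
  have hker : ∀ x ∈ facePrime k M G, e x = 0 := by
    refine fun x hx => (Ideal.span_le (I := RingHom.ker e)).mpr ?_ hx
    rintro _ ⟨a, ha, rfl⟩
    exact (he a).trans (dif_neg ha)
  let q := Ideal.Quotient.liftₐ (facePrime k M G) e hker
  have hq : ∀ y : faceMonomialsBar k M F G, IsUnit (q y) := by
    rintro ⟨_, _, ⟨a, ha, rfl⟩, rfl⟩
    change IsUnit (e (.single a 1))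
    rw [he, hg a (hFG ha)]
    refine IsUnit.of_mul_eq_one (.single ⟨-a, neg_mem_differenceSubmonoid ha⟩ 1) ?_
    rw [AddMonoidAlgebra.single_mul_single, one_mul, AddMonoidAlgebra.one_def]
    congr 1
    exact Subtype.ext (add_neg_cancel _)
  refine ⟨IsLocalization.liftAlgHom (M := faceMonomialsBar k M F G)
    (S := Localization (faceMonomialsBar k M F G)) hq, fun a ha => ?_⟩
  change IsLocalization.liftAlgHom (M := faceMonomialsBar k M F G)
    (S := Localization (faceMonomialsBar k M F G)) hq
    (algebraMap _ _ (Ideal.Quotient.mk (facePrime k M G) (.single a 1))) = _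
  rw [IsLocalization.liftAlgHom_apply, IsLocalization.lift_eq]
  exact (he a).trans (hg a ha)

theorem nonempty_localization_algEquiv (hF : F ≤ M) (hG : IsFace M G) (hFG : F ≤ G) :
    Nonempty (Localization (faceMonomialsBar k M F G) ≃ₐ[k]
      AddMonoidAlgebra k (differenceSubmonoid G F)) := by
  obtain ⟨φ, hφ⟩ := exists_algHom_to_localization (k := k) hF hG.1
  obtain ⟨ψ, hψ⟩ := exists_algHom_from_localization (k := k) hG hFG
  refine ⟨AlgEquiv.ofAlgHom ψ φ ?_ ?_⟩
  · refine AddMonoidAlgebra.algHom_ext (fun c => ?_) (Subsingleton.elim _ _)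
    change ψ (φ (.single c 1)) = .single c 1
    obtain ⟨a, ha, b, hb, hab⟩ := c.2
    have h := congrArg ψ (hφ c ⟨a, hG.1 ha⟩ ⟨b, hF hb⟩ ha hb hab)
    rw [map_mul, hψ ⟨a, hG.1 ha⟩ ha, hψ ⟨b, hF hb⟩ (hFG hb)] at h
    have h' := congrArg (· * AddMonoidAlgebra.single
      (⟨-b, neg_mem_differenceSubmonoid hb⟩ : differenceSubmonoid G F) (1 : k)) h
    simp only [mul_assoc, AddMonoidAlgebra.single_mul_single, one_mul] at h'
    have hb0 : (⟨b, le_differenceSubmonoid (hFG hb)⟩ : differenceSubmonoid G F) +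
        ⟨-b, neg_mem_differenceSubmonoid hb⟩ = 0 := Subtype.ext (add_neg_cancel b)
    have hc : (⟨a, le_differenceSubmonoid ha⟩ : differenceSubmonoid G F) +
        ⟨-b, neg_mem_differenceSubmonoid hb⟩ = c :=
      Subtype.ext ((sub_eq_add_neg a b).symm.trans hab.symm)
    rw [hb0, hc, ← AddMonoidAlgebra.one_def, mul_one] at h'
    exact h'
  · refine IsLocalization.algHom_ext (R := k) (L := Localization (faceMonomialsBar k M F G))
      (faceMonomialsBar k M F G) ?_
    refine Ideal.Quotient.algHom_ext _
      (AddMonoidAlgebra.algHom_ext (fun a => ?_) (Subsingleton.elim _ _))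
    change φ (ψ (localizedMonomial k M F G (.ofAdd a))) = localizedMonomial k M F G (.ofAdd a)
    by_cases ha : (a : Fin n → ℤ) ∈ G
    · have h := hφ ⟨a, le_differenceSubmonoid ha⟩ a 0 ha F.zero_mem (by simp)
      rwa [ofAdd_zero, map_one, mul_one, ← hψ a ha] at h
    · rw [localizedMonomial_eq_zero ha, map_zero, map_zero]

end Localization

end AffineSemigroup

theorem localization_of_quotient_at_face_monomials
    (k : Type*) [Field k] (n : ℕ) (hn : 1 ≤ n)
    (M : AddSubmonoid (Fin n → ℤ)) (hM : M.FG)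
    (F G : AddSubmonoid (Fin n → ℤ)) (hF : IsFace M F) (hG : IsFace M G) :
    (¬ F ≤ G → Subsingleton (Localization (faceMonomialsBar k M F G))) ∧
    (F ≤ G → ∃ N : AddSubmonoid (Fin n → ℤ),
      (N : Set (Fin n → ℤ)) = {c | ∃ a ∈ G, ∃ b ∈ F, c = a - b} ∧
      Nonempty (Localization (faceMonomialsBar k M F G) ≃ₐ[k] AddMonoidAlgebra k N)) := by
  refine ⟨AffineSemigroup.subsingleton_localization_of_not_le hF.1, fun hFG =>
    ⟨AffineSemigroup.differenceSubmonoid G F, rfl,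
      AffineSemigroup.nonempty_localization_algEquiv hF.1 hG hFG⟩⟩
end

section
/- Let k be a field and M an affine semigroup in ℤ^n whose generated subgroup is all of ℤ^n (ℤM = ℤ^n). Let M̄ := {a ∈ ℤ^n : m • a ∈ M for some integer m ≥ 1} be the saturation of M. Then M̄ is a finitely generated submonoid of ℤ^n containing M, the inclusion k[M] ⊆ k[M̄] is an integral ring extension inducing an isomorphism of fraction fields, and k[M̄] is integrally closed in its fraction field; consequently k[M̄] is the normalization (integral closure in the fraction field) of k[M]. -/
/-- The saturation `M̄ = {a ∈ ℤⁿ : m • a ∈ M for some integer m ≥ 1}` of a submonoid `M ⊆ ℤⁿ`. -/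
def saturation {n : ℕ} (M : AddSubmonoid (Fin n → ℤ)) : AddSubmonoid (Fin n → ℤ) where
  carrier := {a | ∃ m : ℕ, 1 ≤ m ∧ m • a ∈ M}
  zero_mem' := ⟨1, le_refl 1, by simpa using M.zero_mem⟩
  add_mem' := by
    rintro a b ⟨m, hm, hma⟩ ⟨l, hl, hlb⟩
    refine ⟨m * l, Nat.one_le_iff_ne_zero.mpr (Nat.mul_ne_zero (by omega) (by omega)), ?_⟩
    have h1 : (m * l) • a = l • (m • a) := by rw [mul_comm, mul_smul]
    have h2 : (m * l) • b = m • (l • b) := by rw [mul_smul]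
    rw [smul_add, h1, h2]
    exact M.add_mem (AddSubmonoid.nsmul_mem M hma l) (AddSubmonoid.nsmul_mem M hlb m)

section Saturation

variable {n : ℕ}

lemma le_saturation (M : AddSubmonoid (Fin n → ℤ)) : M ≤ saturation M :=
  fun a ha ↦ ⟨1, le_rfl, by simpa using ha⟩

lemma nsmulSaturated_saturation (M : AddSubmonoid (Fin n → ℤ)) :
    (saturation M).NSMulSaturated := by
  rintro m a ⟨l, hl, h⟩
  refine or_iff_not_imp_left.2 fun hm ↦ ⟨l * m, Nat.mul_pos hl (Nat.pos_of_ne_zero hm), ?_⟩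
  rwa [mul_smul]

/-- **Gordan's lemma**: the saturation of a finitely generated submonoid of `ℤⁿ` is finitely
generated. -/
lemma saturation_fg {M : AddSubmonoid (Fin n → ℤ)} (hM : M.FG) : (saturation M).FG := by
  obtain ⟨S, rfl⟩ := hM
  let B : Fin n → ℤ := ∑ s ∈ S, |s|
  let T : Set (Fin n → ℤ) :=
    Set.Icc (-B) B ∩ saturation (AddSubmonoid.closure (S : Set (Fin n → ℤ)))
  refine (AddSubmonoid.fg_iff _).2 ⟨S ∪ T, le_antisymm ?_ ?_,
    S.finite_toSet.union ((Set.finite_Icc _ _).inter_of_left _)⟩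
  · rw [AddSubmonoid.closure_le]
    exact Set.union_subset (AddSubmonoid.subset_closure.trans (le_saturation _))
      Set.inter_subset_right
  rintro a ⟨m, hm, ha⟩
  obtain ⟨c, -, hc⟩ := AddSubmonoid.mem_closure_finset.1 ha
  set r : Fin n → ℤ := a - ∑ s ∈ S, (c s / m) • s with hr
  have hmr : m • r = ∑ s ∈ S, (c s % m) • s := by
    rw [hr, smul_sub, ← hc, Finset.smul_sum, ← Finset.sum_sub_distrib]
    refine Finset.sum_congr rfl fun s _ ↦ ?_
    rw [sub_eq_iff_eq_add, ← mul_smul, ← add_smul, Nat.mod_add_div]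
  have hrT : r ∈ T := by
    refine ⟨?_, m, hm, ?_⟩
    · have key (j : Fin n) : |r j| ≤ B j := by
        have hm' : (0 : ℤ) < m := by exact_mod_cast hm
        refine le_of_mul_le_mul_left ?_ hm'
        have h1 : (m : ℤ) * r j = ∑ s ∈ S, ((c s % m : ℕ) : ℤ) * s j := by
          simpa using congrFun hmr j
        calc (m : ℤ) * |r j| = |∑ s ∈ S, ((c s % m : ℕ) : ℤ) * s j| := by
              rw [← h1, abs_mul, abs_of_pos hm']
          _ ≤ ∑ s ∈ S, |((c s % m : ℕ) : ℤ) * s j| := Finset.abs_sum_le_sum_abs _ _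
          _ ≤ ∑ s ∈ S, (m : ℤ) * |s j| := by
              refine Finset.sum_le_sum fun s _ ↦ ?_
              rw [abs_mul, Nat.abs_cast]
              gcongr
              exact (Nat.mod_lt _ hm).le
          _ = (m : ℤ) * B j := by simp [B, Finset.mul_sum]
      exact ⟨fun j ↦ (abs_le.1 (key j)).1, fun j ↦ (abs_le.1 (key j)).2⟩
    · rw [hmr]
      exact sum_mem fun s hs ↦ nsmul_mem (AddSubmonoid.subset_closure hs) _
  have : a = r + ∑ s ∈ S, (c s / m) • s := by simp [hr]
  rw [this]
  exact add_mem (AddSubmonoid.subset_closure (.inr hrT))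
    (sum_mem fun s hs ↦ nsmul_mem (AddSubmonoid.subset_closure (.inl hs)) _)

/-- A saturated submonoid of `ℤⁿ` is the intersection of the nonnegative cones of total
group preorders containing it. -/
lemma exists_total_saturated_notMem {N : AddSubmonoid (Fin n → ℤ)} (hN : N.NSMulSaturated)
    {a : Fin n → ℤ} (ha : a ∉ N) :
    ∃ P : AddSubmonoid (Fin n → ℤ), N ≤ P ∧ a ∉ P ∧ ∀ b, b ∈ P ∨ -b ∈ P := by
  obtain ⟨P, hNP, hP⟩ := zorn_le_nonempty₀
    {P : AddSubmonoid (Fin n → ℤ) | P.NSMulSaturated ∧ a ∉ P} (fun c hc hchain Q hQ ↦ by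
      have hmem {x} : x ∈ sSup c ↔ ∃ s ∈ c, x ∈ s :=
        AddSubmonoid.mem_sSup_of_directedOn ⟨Q, hQ⟩ hchain.directedOn
      refine ⟨sSup c, ⟨fun m g hg ↦ ?_, fun h ↦ ?_⟩, fun z hz ↦ le_sSup hz⟩
      · obtain ⟨s, hs, hg⟩ := hmem.1 hg
        exact ((hc hs).1 hg).imp_right fun h ↦ hmem.2 ⟨s, hs, h⟩
      · obtain ⟨s, hs, hg⟩ := hmem.1 h
        exact (hc hs).2 hg) N ⟨hN, ha⟩
  refine ⟨P, hNP, hP.prop.2, fun b ↦ ?_⟩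
  have key (b : Fin n → ℤ) (hb : b ∉ P) :
      ∃ m : ℕ, 1 ≤ m ∧ ∃ p ∈ P, ∃ i : ℕ, p + i • b = m • a := by
    by_contra hcon
    have hle : P ⊔ AddSubmonoid.multiples b ≤ saturation (P ⊔ AddSubmonoid.multiples b) :=
      le_saturation _
    refine hb (hP.le_of_ge ⟨nsmulSaturated_saturation _, ?_⟩ (le_sup_left.trans hle)
      (hle (le_sup_right (a := P) (AddSubmonoid.mem_multiples b))))
    rintro ⟨m, hm, hma⟩
    obtain ⟨p, hp, q, ⟨i, rfl⟩, hpq⟩ := AddSubmonoid.mem_sup.1 hma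
    exact hcon ⟨m, hm, p, hp, i, hpq⟩
  by_contra! hb
  obtain ⟨m, hm, p, hp, i, hi⟩ := key b hb.1
  obtain ⟨l, hl, q, hq, j, hj⟩ := key (-b) hb.2
  have hmem : (j * m + i * l) • a ∈ P := by
    have : (j * m + i * l) • a = j • p + i • q := by
      rw [add_smul, mul_smul, mul_smul, ← hi, ← hj, smul_add, smul_add, smul_comm i j, smul_neg,
        smul_neg]
      abel
    rw [this]
    exact add_mem (nsmul_mem hp _) (nsmul_mem hq _)
  rcases hP.prop.1 hmem with h0 | h
  · have hj0 : j = 0 := by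
      have := (Nat.add_eq_zero_iff.1 h0).1
      exact (Nat.mul_eq_zero.1 this).resolve_right (by omega)
    subst hj0
    rw [zero_smul, add_zero] at hj
    exact hP.prop.2 ((hP.prop.1 (hj ▸ hq)).resolve_left (by omega))
  · exact hP.prop.2 h

end Saturation

namespace AddMonoidAlgebra

section Supported

variable {k G : Type*} [CommRing k]

/-- The subring of `k[G]` of elements supported in the submonoid `P`. -/
def supportedSubring [AddCommGroup G] (k : Type*) [CommRing k] (P : AddSubmonoid G) :
    Subring (AddMonoidAlgebra k G) where
  carrier := {f | ∀ g, f.coeff g ≠ 0 → g ∈ P}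
  zero_mem' := by simp
  one_mem' g hg := by
    classical
    rw [one_def, coeff_single, Finsupp.single_apply] at hg
    rw [← of_not_not fun h ↦ hg (if_neg h)]
    exact zero_mem P
  add_mem' {x y} hx hy g hg := by
    by_cases h : x.coeff g = 0
    · exact hy g (by simpa [h] using hg)
    · exact hx g h
  neg_mem' {x} hx g hg := hx g (by simpa using hg)
  mul_mem' {x y} hx hy g hg := by
    classical
    obtain ⟨a, ha, b, hb, rfl⟩ := Finset.mem_add.1
      (support_coeff_mul_subset x y (Finsupp.mem_support_iff.2 hg))
    exact add_mem (hx a (Finsupp.mem_support_iff.1 ha)) (hy b (Finsupp.mem_support_iff.1 hb))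

/-- The elements of `k[G]` whose support consists of elements of `P` that are not invertible
in `P`. -/
def nonunitSupported [AddCommGroup G] (k : Type*) [CommRing k] (P : AddSubmonoid G) :
    AddSubgroup (AddMonoidAlgebra k G) where
  carrier := {f | ∀ g, f.coeff g ≠ 0 → g ∈ P ∧ -g ∉ P}
  zero_mem' := by simp
  add_mem' {x y} hx hy g hg := by
    by_cases h : x.coeff g = 0
    · exact hy g (by simpa [h] using hg)
    · exact hx g h
  neg_mem' {x} hx g hg := hx g (by simpa using hg)

variable [AddCommGroup G] {P : AddSubmonoid G}

lemma mul_mem_nonunitSupported {x y : AddMonoidAlgebra k G} (hx : x ∈ nonunitSupported k P)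
    (hy : y ∈ supportedSubring k P) : x * y ∈ nonunitSupported k P := by
  classical
  intro g hg
  obtain ⟨a, ha, b, hb, rfl⟩ := Finset.mem_add.1
    (support_coeff_mul_subset x y (Finsupp.mem_support_iff.2 hg))
  obtain ⟨haP, haP'⟩ := hx a (Finsupp.mem_support_iff.1 ha)
  have hbP := hy b (Finsupp.mem_support_iff.1 hb)
  exact ⟨add_mem haP hbP, fun h ↦ haP' (by simpa using add_mem hbP h)⟩

lemma single_mem_nonunitSupported {a : G} (r : k) (ha : a ∈ P) (ha' : -a ∉ P) :
    single a r ∈ nonunitSupported k P := by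
  classical
  intro g hg
  rw [coeff_single, Finsupp.single_apply] at hg
  rw [← of_not_not fun h ↦ hg (if_neg h)]
  exact ⟨ha, ha'⟩

lemma nonunitSupported_le_supportedSubring {x : AddMonoidAlgebra k G}
    (hx : x ∈ nonunitSupported k P) : x ∈ supportedSubring k P := fun g hg ↦ (hx g hg).1

/-- A finite nonempty set has a least element for the preorder with nonnegative cone `P`. -/
lemma _root_.Finset.exists_forall_sub_mem (hP : ∀ b, b ∈ P ∨ -b ∈ P) {s : Finset G}
    (hs : s.Nonempty) : ∃ a ∈ s, ∀ b ∈ s, b - a ∈ P := by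
  induction hs using Finset.Nonempty.cons_induction with
  | singleton a => exact ⟨a, by simp, by simp⟩
  | cons c s hc _ ih =>
    obtain ⟨a, ha, hmin⟩ := ih
    rcases hP (c - a) with h | h
    · refine ⟨a, by simp [ha], fun b hb ↦ ?_⟩
      rcases Finset.mem_cons.1 hb with rfl | hb
      exacts [h, hmin b hb]
    · refine ⟨c, by simp, fun b hb ↦ ?_⟩
      rcases Finset.mem_cons.1 hb with rfl | hb
      · simp
      · have := add_mem (hmin b hb) h
        rwa [neg_sub, sub_add_sub_cancel] at this

/-- If `P` is the nonnegative cone of a total group preorder on `G`, then the elements of `k[G]`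
supported in `P` form an integrally closed subring. -/
lemma mem_supportedSubring_of_eval_eq_zero [IsDomain (AddMonoidAlgebra k G)]
    (hP : ∀ b, b ∈ P ∨ -b ∈ P) {p : Polynomial (AddMonoidAlgebra k G)} (hp : p.Monic)
    (hcoeff : ∀ i, p.coeff i ∈ supportedSubring k P) {x : AddMonoidAlgebra k G}
    (hx : p.eval x = 0) : x ∈ supportedSubring k P := by
  classical
  by_contra hxP
  obtain ⟨e, he, heP⟩ : ∃ e, x.coeff e ≠ 0 ∧ e ∉ P := by
    by_contra! h
    exact hxP h
  obtain ⟨a, ha, hmin⟩ := Finset.exists_forall_sub_mem hP (s := x.coeff.support)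
    ⟨e, Finsupp.mem_support_iff.2 he⟩
  have haP : a ∉ P := fun h ↦ heP <| by
    simpa using add_mem (hmin e (Finsupp.mem_support_iff.2 he)) h
  have hu : (single (-a) 1 : AddMonoidAlgebra k G) ∈ nonunitSupported k P :=
    single_mem_nonunitSupported 1 ((hP a).resolve_left haP) (by simpa using haP)
  set u : AddMonoidAlgebra k G := single (-a) 1
  set y := u * x with hydef
  have hycoeff (g : G) : y.coeff g = x.coeff (a + g) := by
    simp [hydef, u, coeff_single_mul_apply]
  have hy : y ∈ supportedSubring k P := fun g hg ↦ by
    simpa using hmin (a + g) (Finsupp.mem_support_iff.2 (by rwa [← hycoeff]))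
  have hyd : y ^ p.natDegree ∈ nonunitSupported k P := by
    rw [Polynomial.eval_eq_sum_range, Finset.sum_range_succ, hp.coeff_natDegree, one_mul,
      add_comm, add_eq_zero_iff_eq_neg] at hx
    rw [hydef, mul_pow, hx, mul_neg, Finset.mul_sum]
    refine neg_mem (sum_mem fun i hi ↦ ?_)
    obtain ⟨j, hj⟩ := Nat.exists_eq_add_of_lt (Finset.mem_range.1 hi)
    have : u ^ p.natDegree * (p.coeff i * x ^ i) = u * (u ^ j * (p.coeff i * y ^ i)) := by
      rw [hydef, hj]
      ring
    rw [this]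
    exact mul_mem_nonunitSupported hu (mul_mem
      (pow_mem (nonunitSupported_le_supportedSubring hu) _) (mul_mem (hcoeff i) (pow_mem hy _)))
  let z : AddMonoidAlgebra k G := ofCoeff (y.coeff.filter fun g ↦ -g ∈ P)
  have hzcoeff (g : G) : z.coeff g = if -g ∈ P then y.coeff g else 0 := Finsupp.filter_apply ..
  have hz : z ∈ supportedSubring k P := fun g hg ↦ hy g fun h ↦ hg (by simp [hzcoeff, h])
  have hz' : z ∈ supportedSubring k (P.comap negAddMonoidHom) := fun g hg ↦
    of_not_not fun h ↦ hg (by rw [hzcoeff]; exact if_neg h)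
  have hyz : y - z ∈ nonunitSupported k P := fun g hg ↦ by
    rw [coeff_sub, Finsupp.sub_apply, hzcoeff] at hg
    split_ifs at hg with h
    · simp at hg
    · exact ⟨hy g (by simpa using hg), h⟩
  have hzd : z ^ p.natDegree ∈ nonunitSupported k P := by
    have h := (Commute.all y z).mul_geom_sum₂ p.natDegree
    have hmem : y ^ p.natDegree - z ^ p.natDegree ∈ nonunitSupported k P := by
      rw [← h]
      exact mul_mem_nonunitSupported hyz
        (sum_mem fun i _ ↦ mul_mem (pow_mem hy _) (pow_mem hz _))
    simpa using sub_mem hyd hmem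
  have hzd0 : z ^ p.natDegree = 0 := by
    ext g
    by_contra hg
    exact (hzd g hg).2 (pow_mem hz' p.natDegree g hg)
  have hz0 := congrArg (fun f ↦ f.coeff 0) (eq_zero_of_pow_eq_zero hzd0)
  simp only [hzcoeff, neg_zero, zero_mem, if_true, hycoeff, add_zero] at hz0
  exact Finsupp.mem_support_iff.1 ha hz0

end Supported

section Localization

variable (k : Type*) {A G : Type*} [CommRing k] [AddCommMonoid A] [AddCommGroup G]

lemma mapDomainRingHom_injective {φ : A →+ G} (hφ : Function.Injective φ) :
    Function.Injective (mapDomainRingHom k φ) := mapDomain_injective hφ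

variable {k} in
lemma exists_mul_single_eq_mapDomainRingHom {φ : A →+ G} (hG : ∀ g, ∃ a b, g + φ a = φ b)
    (x : AddMonoidAlgebra k G) :
    ∃ (a : A) (y : AddMonoidAlgebra k A), x * single (φ a) 1 = mapDomainRingHom k φ y := by
  induction x using induction_linear with
  | zero => exact ⟨0, 0, by simp⟩
  | add x x' hx hx' =>
    obtain ⟨a, y, h⟩ := hx
    obtain ⟨a', y', h'⟩ := hx'
    refine ⟨a + a', y * single a' 1 + y' * single a 1, ?_⟩
    have hs : (single (φ (a + a')) 1 : AddMonoidAlgebra k G) =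
        single (φ a) 1 * single (φ a') 1 := by simp [single_mul_single]
    rw [hs, map_add, map_mul, map_mul, ← h, ← h']
    simp only [mapDomainRingHom_apply, mapDomain_single]
    ring
  | single g r =>
    obtain ⟨a, b, hab⟩ := hG g
    exact ⟨a, single b r, by simp [single_mul_single, hab]⟩

/-- If every element of the group `G` is a difference of elements of the submonoid `A`, then
`k[G]` is the localization of `k[A]` at the monomials. -/
lemma isLocalization_mrange_of {φ : A →+ G} (hφ : Function.Injective φ)
    (hG : ∀ g, ∃ a b, g + φ a = φ b) :
    letI := (mapDomainRingHom k φ).toAlgebra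
    IsLocalization (MonoidHom.mrange (of k A)) (AddMonoidAlgebra k G) := by
  let := (mapDomainRingHom k φ).toAlgebra
  have hmap (x : AddMonoidAlgebra k A) :
      algebraMap (AddMonoidAlgebra k A) (AddMonoidAlgebra k G) x = mapDomainRingHom k φ x := rfl
  refine ⟨⟨?_, ?_, ?_⟩⟩
  · rintro ⟨_, a, rfl⟩
    refine IsUnit.of_mul_eq_one (single (-φ a.toAdd) 1) ?_
    simp [hmap, single_mul_single, one_def]
  · intro x
    obtain ⟨a, y, h⟩ := exists_mul_single_eq_mapDomainRingHom hG x
    exact ⟨(y, ⟨_, .ofAdd a, rfl⟩), by simpa [hmap] using h⟩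
  · intro x y h
    exact ⟨1, by rw [mapDomainRingHom_injective k hφ h]⟩

lemma mrange_of_le_nonZeroDivisors [IsDomain (AddMonoidAlgebra k A)] :
    MonoidHom.mrange (of k A) ≤ nonZeroDivisors (AddMonoidAlgebra k A) := by
  have := (IsDomain.toNontrivial (α := AddMonoidAlgebra k A))
  have : Nontrivial k := by
    by_contra h
    rw [not_nontrivial_iff_subsingleton] at h
    exact zero_ne_one (α := AddMonoidAlgebra k A) (by ext; exact Subsingleton.elim _ _)
  rintro _ ⟨a, rfl⟩
  exact mem_nonZeroDivisors_of_ne_zero (by simp)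

end Localization

section LaurentPolynomial

instance isIntegrallyClosed_pi_int (k : Type*) [Field k] (n : ℕ) :
    IsIntegrallyClosed (AddMonoidAlgebra k (Fin n → ℤ)) := by
  let φ : (Fin n →₀ ℕ) →+ (Fin n → ℤ) :=
    { toFun f i := f i
      map_zero' := by ext; simp
      map_add' f g := by ext; simp }
  have hφ : Function.Injective φ := fun f g h ↦ by
    ext i
    exact Nat.cast_injective (R := ℤ) (congrFun h i)
  have hG (g : Fin n → ℤ) : ∃ a b, g + φ a = φ b := by
    refine ⟨Finsupp.equivFunOnFinite.symm fun i ↦ (-g i).toNat,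
      Finsupp.equivFunOnFinite.symm fun i ↦ (g i).toNat, funext fun i ↦ ?_⟩
    change g i + ((-g i).toNat : ℤ) = (g i).toNat
    omega
  let := (mapDomainRingHom k φ).toAlgebra
  have := isLocalization_mrange_of k hφ hG
  have : IsIntegrallyClosed (AddMonoidAlgebra k (Fin n →₀ ℕ)) :=
    inferInstanceAs (IsIntegrallyClosed (MvPolynomial (Fin n) k))
  have : IsDomain (AddMonoidAlgebra k (Fin n →₀ ℕ)) :=
    inferInstanceAs (IsDomain (MvPolynomial (Fin n) k))
  exact isIntegrallyClosed_of_isLocalization _ (MonoidHom.mrange (of k (Fin n →₀ ℕ)))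
    (mrange_of_le_nonZeroDivisors k)

end LaurentPolynomial

end AddMonoidAlgebra

namespace AddMonoidAlgebra

lemma exists_add_eq_of_closure_eq_top {G : Type*} [AddCommGroup G] {N : AddSubmonoid G}
    (hN : AddSubgroup.closure (N : Set G) = ⊤) (g : G) :
    ∃ a b : N, g + N.subtype a = N.subtype b := by
  have hg : g ∈ AddSubgroup.closure (N : Set G) := hN ▸ AddSubgroup.mem_top g
  induction hg using AddSubgroup.closure_induction with
  | mem x hx => exact ⟨0, ⟨x, hx⟩, by simp⟩
  | zero => exact ⟨0, 0, by simp⟩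
  | add x y _ _ hx hy =>
    obtain ⟨a, b, h⟩ := hx
    obtain ⟨a', b', h'⟩ := hy
    exact ⟨a + a', b + b', by rw [map_add, map_add, ← h, ← h']; abel⟩
  | neg x _ hx =>
    obtain ⟨a, b, h⟩ := hx
    exact ⟨b, a, by rw [← h]; abel⟩

section Field

variable (k : Type*) [Field k] {n : ℕ} {N : AddSubmonoid (Fin n → ℤ)}

instance isDomain_addSubmonoid_pi_int : IsDomain (AddMonoidAlgebra k N) :=
  (mapDomainRingHom_injective k (φ := N.subtype) N.subtype_injective).isDomain _

variable {k}

lemma mapDomainRingHom_subtype_mem (y : AddMonoidAlgebra k N) :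
    mapDomainRingHom k N.subtype y ∈ supportedSubring k N := by
  induction y using induction_linear with
  | zero => simp
  | add x y hx hy => rw [map_add]; exact add_mem hx hy
  | single a r =>
    classical
    intro g hg
    rw [mapDomainRingHom_apply, mapDomain_single, coeff_single, Finsupp.single_apply] at hg
    rw [← of_not_not fun h ↦ hg (if_neg h)]
    exact a.2

lemma exists_mapDomainRingHom_subtype_eq {x : AddMonoidAlgebra k (Fin n → ℤ)}
    (hx : x ∈ supportedSubring k N) : ∃ y, mapDomainRingHom k N.subtype y = x :=
  ⟨comapDomain N.subtype N.subtype_injective x, mapDomain_comapDomain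
    (fun g hg ↦ ⟨⟨g, hx g (Finsupp.mem_support_iff.1 hg)⟩, rfl⟩) _⟩

/-- If `N` is a saturated submonoid of `ℤⁿ`, then `k[N]` is integrally closed in `k[ℤⁿ]`. -/
lemma exists_mapDomainRingHom_subtype_eq_of_isIntegralElem (hN : N.NSMulSaturated)
    {x : AddMonoidAlgebra k (Fin n → ℤ)} (hx : (mapDomainRingHom k N.subtype).IsIntegralElem x) :
    ∃ y, mapDomainRingHom k N.subtype y = x := by
  refine exists_mapDomainRingHom_subtype_eq fun a ha ↦ by_contra fun haN ↦ ?_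
  obtain ⟨P, hNP, haP, hP⟩ := exists_total_saturated_notMem hN haN
  obtain ⟨p, hp, hpx⟩ := hx
  refine haP (mem_supportedSubring_of_eval_eq_zero hP (hp.map (mapDomainRingHom k N.subtype))
    (fun i ↦ ?_) (by rwa [Polynomial.eval_map]) a ha)
  rw [Polynomial.coeff_map]
  exact fun g hg ↦ hNP (mapDomainRingHom_subtype_mem _ g hg)

lemma isIntegrallyClosed_of_nsmulSaturated (hN : N.NSMulSaturated)
    (hclosure : AddSubgroup.closure (N : Set (Fin n → ℤ)) = ⊤) :
    IsIntegrallyClosed (AddMonoidAlgebra k N) := by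
  let R := AddMonoidAlgebra k N
  let S := AddMonoidAlgebra k (Fin n → ℤ)
  let K := FractionRing R
  let : Algebra R S := (mapDomainRingHom k N.subtype).toAlgebra
  have hloc : IsLocalization (MonoidHom.mrange (of k N)) S :=
    isLocalization_mrange_of k N.subtype_injective (exists_add_eq_of_closure_eq_top hclosure)
  have hle := mrange_of_le_nonZeroDivisors k (A := N)
  let : Algebra S K := IsLocalization.localizationAlgebraOfSubmonoidLe S K _ _ hle
  have : IsScalarTower R S K :=
    IsLocalization.localization_isScalarTower_of_submonoid_le S K _ _ hle
  have : IsFractionRing S K :=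
    IsFractionRing.isFractionRing_of_isDomain_of_isLocalization (MonoidHom.mrange (of k N)) S K
  refine (isIntegrallyClosed_iff K).2 fun {x} hx ↦ ?_
  obtain ⟨s, rfl⟩ := (isIntegrallyClosed_iff (R := S) K).1 inferInstance (hx.tower_top (A := S))
  have hs : IsIntegral R s :=
    (isIntegral_algebraMap_iff (IsFractionRing.injective S K)).1 hx
  obtain ⟨y, rfl⟩ := exists_mapDomainRingHom_subtype_eq_of_isIntegralElem hN hs
  exact ⟨y, IsScalarTower.algebraMap_apply R S K y⟩

lemma isIntegral_mapDomainRingHom_inclusion_saturation {M : AddSubmonoid (Fin n → ℤ)}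
    (h : M ≤ saturation M) :
    (mapDomainRingHom k (AddSubmonoid.inclusion h)).IsIntegral := by
  intro x
  induction x using induction_linear with
  | zero => exact RingHom.isIntegralElem_zero _
  | add x y hx hy => exact hx.add _ hy
  | single a r =>
    obtain ⟨a, m, hm, ha⟩ := a
    let := (mapDomainRingHom k (AddSubmonoid.inclusion h)).toAlgebra
    refine IsIntegral.of_pow hm ?_
    convert! RingHom.isIntegralElem_map (mapDomainRingHom k (AddSubmonoid.inclusion h))
      (x := single ⟨m • a, ha⟩ (r ^ m))
    simp only [single_pow, mapDomainRingHom_apply, mapDomain_single]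
    rfl

lemma exists_mul_mapDomainRingHom_inclusion_eq {M M' : AddSubmonoid (Fin n → ℤ)}
    (hM : AddSubgroup.closure (M : Set (Fin n → ℤ)) = ⊤) (h : M ≤ M')
    (x : AddMonoidAlgebra k M') :
    ∃ y : AddMonoidAlgebra k M, ∃ z ∈ nonZeroDivisors (AddMonoidAlgebra k M),
      x * mapDomainRingHom k (AddSubmonoid.inclusion h) z =
        mapDomainRingHom k (AddSubmonoid.inclusion h) y := by
  obtain ⟨a, y, hy⟩ := exists_mul_single_eq_mapDomainRingHom
    (exists_add_eq_of_closure_eq_top hM) (mapDomainRingHom k M'.subtype x)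
  have hcomp (w : AddMonoidAlgebra k M) :
      mapDomainRingHom k M'.subtype (mapDomainRingHom k (AddSubmonoid.inclusion h) w) =
        mapDomainRingHom k M.subtype w := by
    rw [← RingHom.comp_apply, ← mapDomainRingHom_comp]
    rfl
  refine ⟨y, single a 1, mem_nonZeroDivisors_of_ne_zero (by simp),
    mapDomainRingHom_injective k M'.subtype_injective ?_⟩
  rw [map_mul, hcomp, hcomp, ← hy]
  congr 1
  exact mapDomain_single

end Field

end AddMonoidAlgebra


/-- The semigroup ring of the saturation of an affine semigroup `M` with `ℤM = ℤⁿ` is the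
normalization of `k[M]`: the saturation is a finitely generated monoid containing `M`, the
induced ring map `k[M] → k[M̄]` is injective and integral, every element of `k[M̄]` is a
fraction of elements coming from `k[M]` (so the fraction fields agree), and `k[M̄]` is
integrally closed in its fraction field. -/
theorem saturation_is_normalization
    (k : Type*) [Field k] (n : ℕ) (hn : 1 ≤ n)
    (M : AddSubmonoid (Fin n → ℤ)) (hM : M.FG)
    (hZ : AddSubgroup.closure (M : Set (Fin n → ℤ)) = ⊤) :
    (saturation M).FG ∧
    ∃ h : M ≤ saturation M,
      Function.Injective (AddMonoidAlgebra.mapDomainRingHom k (AddSubmonoid.inclusion h)) ∧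
      RingHom.IsIntegral (AddMonoidAlgebra.mapDomainRingHom k (AddSubmonoid.inclusion h)) ∧
      (∀ x : AddMonoidAlgebra k (saturation M),
        ∃ y : AddMonoidAlgebra k M, ∃ z ∈ nonZeroDivisors (AddMonoidAlgebra k M),
          x * (AddMonoidAlgebra.mapDomainRingHom k (AddSubmonoid.inclusion h)) z
            = (AddMonoidAlgebra.mapDomainRingHom k (AddSubmonoid.inclusion h)) y) ∧
      IsIntegrallyClosed (AddMonoidAlgebra k (saturation M)) := by
  have hclosure : AddSubgroup.closure (saturation M : Set (Fin n → ℤ)) = ⊤ :=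
    top_le_iff.1 (hZ.ge.trans (AddSubgroup.closure_mono (le_saturation M)))
  exact ⟨saturation_fg hM, le_saturation M,
    AddMonoidAlgebra.mapDomain_injective (AddSubmonoid.inclusion_injective _),
    AddMonoidAlgebra.isIntegral_mapDomainRingHom_inclusion_saturation _,
    AddMonoidAlgebra.exists_mul_mapDomainRingHom_inclusion_eq hZ _,
    AddMonoidAlgebra.isIntegrallyClosed_of_nsmulSaturated (nsmulSaturated_saturation M) hclosure⟩
end

section
/- Let k be a field and M a positive affine semigroup in ℤ^n, and let m be the maximal ideal of k[M] generated by the monomials t^a with 0 ≠ a ∈ M. Then k[M] is a Cohen–Macaulay ring if and only if the localization k[M]_m is a Cohen–Macaulay local ring. -/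
/-- A commutative ring is a Cohen–Macaulay local ring if it is Noetherian local and admits a
regular sequence of nonunits (i.e. elements of the maximal ideal) whose length equals its Krull
dimension. -/
def IsCMLocalRing (R : Type*) [CommRing R] : Prop :=
  IsLocalRing R ∧ IsNoetherianRing R ∧
    ∃ rs : List R, (∀ r ∈ rs, ¬ IsUnit r) ∧ RingTheory.Sequence.IsRegular R rs ∧
      (rs.length : WithBot (WithTop ℕ)) = ringKrullDim R

/-- A commutative ring is Cohen–Macaulay if it is Noetherian and its localization at every
prime ideal is a Cohen–Macaulay local ring. -/
def IsCMRing (R : Type*) [CommRing R] : Prop :=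
  IsNoetherianRing R ∧ ∀ (p : Ideal R) (hp : p.IsPrime),
    IsCMLocalRing (Localization (@Ideal.primeCompl R _ p hp))

open RingTheory.Sequence IsLocalRing

/-- In a Noetherian local ring, a weakly regular sequence in the maximal ideal whose length is at
least the Krull dimension witnesses the Cohen–Macaulay property. -/
theorem isCMLocalRing_of_isWeaklyRegular {R : Type*} [CommRing R] [IsLocalRing R]
    [IsNoetherianRing R] (rs : List R) (mem : ∀ r ∈ rs, r ∈ maximalIdeal R)
    (reg : IsWeaklyRegular R rs) (hdim : ringKrullDim R ≤ rs.length) : IsCMLocalRing R := by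
  have hreg : IsRegular R rs := .of_isWeaklyRegular_of_mem_maximalIdeal R mem reg
  refine ⟨‹_›, ‹_›, rs, mem, hreg, le_antisymm ?_ hdim⟩
  rw [← ringKrullDim_add_length_eq_ringKrullDim_of_isRegular rs hreg]
  have : Nontrivial (R ⧸ Ideal.ofList rs) := Ideal.Quotient.nontrivial_iff.mpr fun h =>
    hreg.top_ne_smul (by simp [h])
  exact le_add_of_nonneg_left ringKrullDim_nonneg_of_nontrivial

theorem IsCMLocalRing.exists_isRegular {R : Type*} [CommRing R] (h : IsCMLocalRing R) :
    ∃ rs : List R, (∀ r ∈ rs, ¬ IsUnit r) ∧ IsRegular R rs ∧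
      (rs.length : WithBot ℕ∞) = ringKrullDim R :=
  h.2.2

theorem IsCMLocalRing.of_ringEquiv {R S : Type*} [CommRing R] [CommRing S] (e : R ≃+* S)
    (h : IsCMLocalRing R) : IsCMLocalRing S := by
  obtain ⟨rs, hrs, hreg, hdim⟩ := h.exists_isRegular
  have := h.1
  have := h.2.1
  have := e.isLocalRing
  have := isNoetherianRing_of_ringEquiv R e
  let := e.toRingHom.toAlgebra
  have : Module.Flat R S := Module.Flat.of_linearEquiv
    (LinearEquiv.ofBijective (Algebra.linearMap R S) e.bijective).symm
  refine isCMLocalRing_of_isWeaklyRegular (rs.map (algebraMap R S)) ?_ (hreg.1.of_flat) ?_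
  · intro r hr
    obtain ⟨x, hx, rfl⟩ := List.mem_map.mp hr
    exact fun hu => hrs x hx ((MulEquiv.isUnit_map e).mp hu)
  · rw [← ringKrullDim_eq_of_ringEquiv e, ← hdim, List.length_map]

theorem IsCMRing.of_ringEquiv {R S : Type*} [CommRing R] [CommRing S] (e : R ≃+* S)
    (h : IsCMRing R) : IsCMRing S := by
  have := h.1
  refine ⟨isNoetherianRing_of_ringEquiv R e, fun p hp => ?_⟩
  exact (h.2 (p.comap e) inferInstance).of_ringEquiv
    (Localization.localRingEquiv _ p e rfl)

theorem isCMRing_of_field (k : Type*) [Field k] : IsCMRing k := by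
  refine ⟨inferInstance, fun p hp => ?_⟩
  have := IsLocalization.isNoetherianRing p.primeCompl (Localization p.primeCompl) inferInstance
  refine isCMLocalRing_of_isWeaklyRegular [] (by simp) (by simp) ?_
  have := IsLocalization.AtPrime.ringKrullDim_eq_height p (Localization p.primeCompl)
  rw [this]
  have h := Ideal.height_le_ringKrullDim_of_ne_top hp.ne_top
  simpa using h

open Polynomial in
/-- A polynomial over a ring with a unit coefficient is regular modulo any ideal extended
from the base. -/
theorem Polynomial.isSMulRegular_quotient_map_C {T : Type*} [CommRing T] (J : Ideal T)
    {f : T[X]} (n : ℕ) (hf : IsUnit (f.coeff n)) :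
    IsSMulRegular (T[X] ⧸ (J.map C)) f := by
  rw [isSMulRegular_iff_right_eq_zero_of_smul]
  intro x hx
  obtain ⟨g, rfl⟩ := Ideal.Quotient.mk_surjective x
  rw [← Ideal.Quotient.mk_eq_mk, ← Submodule.Quotient.mk_smul, Submodule.Quotient.mk_eq_zero] at hx
  rw [Ideal.Quotient.eq_zero_iff_mem]
  have key : ∀ q : T[X], q ∈ J.map C ↔ q.map (Ideal.Quotient.mk J) = 0 := by
    intro q
    simp [Ideal.mem_map_C_iff, Polynomial.ext_iff, Ideal.Quotient.eq_zero_iff_mem]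
  rw [key] at hx ⊢
  have hreg := Polynomial.mem_nonzeroDivisors_of_coeff_mem (p := f.map (Ideal.Quotient.mk J)) n
    (by rw [coeff_map]; exact (hf.map _).mem_nonZeroDivisors)
  rw [smul_eq_mul, Polynomial.map_mul] at hx
  exact (mul_left_mem_nonZeroDivisors_eq_zero_iff hreg).mp hx

open Polynomial in
theorem Polynomial.isCMLocalRing_localization_of_comap_eq_maximalIdeal {T : Type*} [CommRing T]
    [IsLocalRing T] (h : IsCMLocalRing T) (P : Ideal T[X]) [P.IsPrime]
    (hP : P.comap C = maximalIdeal T) : IsCMLocalRing (Localization.AtPrime P) := by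
  obtain ⟨rs, hrs, hreg, hdim⟩ := h.exists_isRegular
  have := h.1
  have := h.2.1
  have := IsLocalization.isNoetherianRing P.primeCompl (Localization.AtPrime P) inferInstance
  have hmem : ∀ r ∈ rs, C r ∈ P := fun r hr => by
    rw [← Ideal.mem_comap, hP]; exact hrs r hr
  have hregX : IsWeaklyRegular T[X] (rs.map (algebraMap T T[X])) := hreg.1.of_flat
  have hle : (maximalIdeal T).map C ≤ P := Ideal.map_le_iff_le_comap.mpr hP.ge
  have key : ∃ ss : List T[X], (∀ s ∈ ss, s ∈ P) ∧ IsWeaklyRegular T[X] ss ∧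
      (P.height : WithBot ℕ∞) ≤ ss.length := by
    by_cases heq : P = (maximalIdeal T).map C
    · refine ⟨rs.map (algebraMap T T[X]), by simpa using hmem, hregX, ?_⟩
      rw [heq, Polynomial.height_map_C, IsLocalRing.maximalIdeal_height_eq_ringKrullDim, ← hdim]
      simp
    · obtain ⟨f, hfP, hf⟩ := SetLike.exists_of_lt (lt_of_le_of_ne hle (Ne.symm heq))
      obtain ⟨n, hn⟩ : ∃ n, IsUnit (f.coeff n) := by
        by_contra! hcon
        exact hf (Ideal.mem_map_C_iff.mpr fun n => hcon n)
      refine ⟨rs.map (algebraMap T T[X]) ++ [f], ?_, ?_, ?_⟩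
      · simp only [List.mem_append, List.mem_map, List.mem_singleton]
        rintro s (⟨r, hr, rfl⟩ | rfl)
        exacts [hmem r hr, hfP]
      · rw [isWeaklyRegular_append_iff, isWeaklyRegular_singleton_iff]
        refine ⟨hregX, ?_⟩
        have hJ : (Ideal.ofList (rs.map (algebraMap T T[X])) • ⊤ : Submodule T[X] T[X]) =
            (Ideal.ofList rs).map C := by
          rw [← Ideal.map_ofList]; simp
        rw [hJ]
        exact Polynomial.isSMulRegular_quotient_map_C _ n hn
      · refine (Ideal.height_le_ringKrullDim_of_ne_top Ideal.IsPrime.ne_top').trans ?_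
        rw [Polynomial.ringKrullDim_of_isNoetherianRing, ← hdim]
        simp
  obtain ⟨ss, hss, hssreg, hlen⟩ := key
  refine isCMLocalRing_of_isWeaklyRegular (ss.map (algebraMap _ _)) ?_
    (hssreg.of_isLocalization (Localization.AtPrime P) P.primeCompl) ?_
  · intro r hr
    obtain ⟨x, hx, rfl⟩ := List.mem_map.mp hr
    exact (IsLocalization.AtPrime.to_map_mem_maximal_iff _ P x).mpr (hss x hx)
  · rw [IsLocalization.AtPrime.ringKrullDim_eq_height P, List.length_map]
    exact hlen

open Polynomial Ideal in
theorem Polynomial.isCMRing {R : Type*} [CommRing R] (h : IsCMRing R) : IsCMRing R[X] := by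
  have := h.1
  refine ⟨inferInstance, fun p hp => ?_⟩
  let q := p.comap C
  let S := (Localization.AtPrime q)[X]
  let pc := Submonoid.map Polynomial.C.toMonoidHom q.primeCompl
  let : Algebra R[X] S := algebra R (Localization.AtPrime q)
  have : IsLocalization pc S := Polynomial.isLocalization _ _
  let pS := p.map (algebraMap R[X] S)
  have disj : Disjoint (pc : Set R[X]) (p : Set R[X]) := by
    simpa [pc, q] using! Set.disjoint_image_left.mpr
      (Set.disjoint_compl_left_iff_subset.mpr (fun _ a ↦ a))
  have : pS.IsPrime := IsLocalization.isPrime_of_isPrime_disjoint pc _ _ ‹_› disj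
  have : IsLocalization.AtPrime (Localization.AtPrime pS) p := by
    convert IsLocalization.isLocalization_isLocalization_atPrime_isLocalization pc
      (Localization.AtPrime pS) pS
    exact (IsLocalization.under_map_of_isPrime_disjoint pc _ ‹_› disj).symm
  have eq : comap C pS = maximalIdeal (Localization.AtPrime q) := by
    rw [← IsLocalization.map_under q.primeCompl _ (comap C pS),
      ← IsLocalization.map_under q.primeCompl _ (maximalIdeal (Localization.AtPrime q))]
    simp only [comap_comap, S, pS]
    rw [← Polynomial.algebraMap_eq (R := Localization.AtPrime q),
      ← IsScalarTower.algebraMap_eq R (Localization.AtPrime q) (Localization.AtPrime q)[X],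
      IsScalarTower.algebraMap_eq R R[X] (Localization.AtPrime q)[X], ← comap_comap,
      ← Ideal.under_def R[X], IsLocalization.under_map_of_isPrime_disjoint pc _ ‹_› disj]
    simp [q, IsLocalization.AtPrime.under_maximalIdeal (Localization.AtPrime q) q]
  exact (isCMLocalRing_localization_of_comap_eq_maximalIdeal (h.2 q inferInstance) pS eq).of_ringEquiv
    (IsLocalization.algEquiv p.primeCompl
      (Localization.AtPrime pS) (Localization.AtPrime p)).toRingEquiv

theorem MvPolynomial.isCMRing_of_field (k : Type*) [Field k] (d : ℕ) :
    IsCMRing (MvPolynomial (Fin d) k) := by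
  induction d with
  | zero => exact (_root_.isCMRing_of_field k).of_ringEquiv (isEmptyRingEquiv k _).symm
  | succ d ih =>
    exact (Polynomial.isCMRing ih).of_ringEquiv (finSuccEquiv k d).symm.toRingEquiv

/-- The height of a prime is at most the height of its contraction along an integral extension. -/
theorem Ideal.height_le_height_comap_of_isIntegral {A R : Type*} [CommRing A] [CommRing R]
    [Algebra A R] [Algebra.IsIntegral A R] (p : Ideal R) [p.IsPrime] :
    p.height ≤ (p.comap (algebraMap A R)).height := by
  rw [PrimeSpectrum.height_eq_orderHeight ⟨p, ‹_›⟩,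
    PrimeSpectrum.height_eq_orderHeight ⟨p.comap (algebraMap A R), inferInstance⟩]
  exact Order.height_le_height_apply_of_strictMono (PrimeSpectrum.comap (algebraMap A R))
    (fun I J hIJ => Ideal.IsIntegral.comap_lt_comap hIJ) ⟨p, ‹_›⟩

/-- A finite flat algebra over a Cohen–Macaulay ring is Cohen–Macaulay. -/
theorem IsCMRing.of_finite_flat {A R : Type*} [CommRing A] [CommRing R] [Algebra A R]
    [Module.Finite A R] [Module.Flat A R] (h : IsCMRing A) : IsCMRing R := by
  have := h.1
  have hR : IsNoetherianRing R := IsNoetherianRing.of_finite A R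
  refine ⟨hR, fun p hp => ?_⟩
  have := IsLocalization.isNoetherianRing p.primeCompl (Localization p.primeCompl) hR
  let q := p.comap (algebraMap A R)
  obtain ⟨rs, hrs, hreg, hdim⟩ := (h.2 q inferInstance).exists_isRegular
  let φ := Localization.localRingHom q p (algebraMap A R) rfl
  let : Algebra (Localization.AtPrime q) (Localization.AtPrime p) := φ.toAlgebra
  have : IsScalarTower A (Localization.AtPrime q) (Localization.AtPrime p) :=
    .of_algebraMap_eq fun x => by
      rw [RingHom.algebraMap_toAlgebra, Localization.localRingHom_to_map,
        ← IsScalarTower.algebraMap_apply]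
  have : Module.Flat (Localization.AtPrime q) (Localization.AtPrime p) :=
    (Module.flat_iff_of_isLocalization (Localization.AtPrime q) q.primeCompl _).mpr inferInstance
  refine isCMLocalRing_of_isWeaklyRegular (R := Localization.AtPrime p)
    (rs.map (algebraMap (Localization.AtPrime q) (Localization.AtPrime p))) ?_ hreg.1.of_flat ?_
  · intro r hr
    obtain ⟨x, hx, rfl⟩ := List.mem_map.mp hr
    have : IsLocalHom φ := inferInstance
    exact fun hu => hrs x hx (this.map_nonunit x hu)
  · rw [IsLocalization.AtPrime.ringKrullDim_eq_height p, List.length_map, hdim,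
      IsLocalization.AtPrime.ringKrullDim_eq_height q]
    exact_mod_cast Ideal.height_le_height_comap_of_isIntegral p

section Rees

universe u

open CategoryTheory Abelian Limits Pointwise

/-- Cutting by a regular element lowers the length of the available regular sequences by at most
one. -/
theorem exists_isRegular_quotSMulTop {R : Type u} [CommRing R] [IsLocalRing R]
    [IsNoetherianRing R] (M : Type u) [AddCommGroup M] [Module R M] [Module.Finite R M]
    (rs : List R) (mem : ∀ r ∈ rs, r ∈ maximalIdeal R) (reg : IsRegular M rs) {n : ℕ}
    (hn : rs.length = n + 1) {x : R} (hx : x ∈ maximalIdeal R) (hxreg : IsSMulRegular M x) :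
    ∃ rs' : List R, rs'.length = n ∧ (∀ r ∈ rs', r ∈ maximalIdeal R) ∧
      IsRegular (QuotSMulTop x M) rs' := by
  have hM : Nontrivial M := reg.nontrivial
  have lt_top : ∀ (N : Type u) [AddCommGroup N] [Module R N] [Module.Finite R N] [Nontrivial N],
      maximalIdeal R • (⊤ : Submodule R N) < ⊤ := fun N _ _ _ _ =>
    (Submodule.top_ne_ideal_smul_of_le_jacobson_annihilator
      (maximalIdeal_le_jacobson _)).symm.lt_top
  have : Nontrivial (QuotSMulTop x M) := nontrivial_quotSMulTop_of_mem_maximalIdeal M hx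
  have hext : ∀ i < n + 1,
      Subsingleton (Ext (ModuleCat.of R (Shrink.{u} (R ⧸ maximalIdeal R))) (ModuleCat.of R M) i) :=
    have hex : ∃ rs : List R, rs.length = n + 1 ∧ (∀ r ∈ rs, r ∈ maximalIdeal R) ∧
        IsRegular (ModuleCat.of R M) rs := ⟨rs, hn, mem, reg⟩
    ((ModuleCat.exists_isRegular_tfae (maximalIdeal R) (n + 1) (ModuleCat.of R M)
      (lt_top M)).out 1 3).mpr hex
  refine ((ModuleCat.exists_isRegular_tfae (maximalIdeal R) n
    (ModuleCat.of R (QuotSMulTop x M)) (lt_top _)).out 1 3).mp fun i hi => ?_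
  have zero1 := AddCommGrpCat.isZero_of_iff_subsingleton.mpr (hext i (by omega))
  have zero2 := AddCommGrpCat.isZero_of_iff_subsingleton.mpr (hext (i + 1) (by omega))
  have hreg' : IsSMulRegular (ModuleCat.of R M) x := hxreg
  exact AddCommGrpCat.subsingleton_of_isZero <| ShortComplex.Exact.isZero_of_both_zeros
    ((Ext.covariant_sequence_exact₃' _ hreg'.smulShortComplex_shortExact) i (i + 1) rfl)
    (zero1.eq_zero_of_src _) (zero2.eq_zero_of_tgt _)

/-- A regular sequence strictly shorter than another one can be extended. -/
theorem exists_isSMulRegular_quotient_of_length_lt {R : Type u} [CommRing R] [IsLocalRing R]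
    [IsNoetherianRing R] (M : Type u) [AddCommGroup M] [Module R M] [Module.Finite R M]
    (ss : List R) (hss : ∀ s ∈ ss, s ∈ maximalIdeal R) (hssreg : IsWeaklyRegular M ss)
    (rs : List R) (mem : ∀ r ∈ rs, r ∈ maximalIdeal R) (reg : IsRegular M rs)
    (hlt : ss.length < rs.length) :
    ∃ x ∈ maximalIdeal R, IsSMulRegular (M ⧸ (Ideal.ofList ss • ⊤ : Submodule R M)) x := by
  induction ss generalizing M rs with
  | nil =>
    match rs, hlt with
    | r :: rs, _ =>
      refine ⟨r, mem r (by simp), ?_⟩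
      have e : (M ⧸ (Ideal.ofList ([] : List R) • ⊤ : Submodule R M)) ≃ₗ[R] M :=
        Submodule.quotEquivOfEqBot _ (by simp)
      exact (e.isSMulRegular_congr r).mpr ((isRegular_cons_iff M r rs).mp reg).1
  | cons s ss ih =>
    obtain ⟨hs, hssreg'⟩ := (isWeaklyRegular_cons_iff M s ss).mp hssreg
    obtain ⟨n, hn⟩ : ∃ n, rs.length = n + 1 := Nat.exists_eq_succ_of_ne_zero (by omega)
    obtain ⟨rs', hlen, hmem', hreg'⟩ := exists_isRegular_quotSMulTop M rs mem reg hn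
      (hss s (by simp)) hs
    obtain ⟨x, hx, hxreg⟩ := ih (QuotSMulTop s M) (fun t ht => hss t (by simp [ht])) hssreg'
      rs' hmem' hreg' (by simp at hlt; omega)
    exact ⟨x, hx, ((Submodule.quotOfListConsSMulTopEquivQuotSMulTopInner M s ss).isSMulRegular_congr
      x).mpr hxreg⟩

theorem notMem_associatedPrimes_of_length_lt {R : Type u} [CommRing R] [IsNoetherianRing R]
    (m : Ideal R) [hm : m.IsMaximal] (ss : List R) (hss : ∀ s ∈ ss, s ∈ m)
    (hssreg : IsWeaklyRegular R ss) (rs : List (Localization.AtPrime m))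
    (mem : ∀ r ∈ rs, r ∈ maximalIdeal (Localization.AtPrime m))
    (reg : IsRegular (Localization.AtPrime m) rs) (hlt : ss.length < rs.length) :
    m ∉ associatedPrimes R (R ⧸ Ideal.ofList ss) := by
  intro hass
  let S := Localization.AtPrime m
  have : IsNoetherianRing S := IsLocalization.isNoetherianRing m.primeCompl S inferInstance
  obtain ⟨_, y', hy'⟩ := isAssociatedPrime_iff.mp hass
  obtain ⟨y, rfl⟩ := Ideal.Quotient.mk_surjective y'
  have hy : ∀ a, a ∈ m ↔ a * y ∈ Ideal.ofList ss := fun a => by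
    rw [hy', Submodule.mem_colon_singleton, Submodule.mem_bot, Algebra.smul_def,
      Ideal.Quotient.algebraMap_eq, ← map_mul, Ideal.Quotient.eq_zero_iff_mem]
  obtain ⟨x, hx, hxreg⟩ := exists_isSMulRegular_quotient_of_length_lt S
    (ss.map (algebraMap R S))
    (by
      intro s hs
      obtain ⟨t, ht, rfl⟩ := List.mem_map.mp hs
      exact (IsLocalization.AtPrime.to_map_mem_maximal_iff S m t).mpr (hss t ht))
    (hssreg.of_isLocalization S m.primeCompl) rs mem reg (by simpa using hlt)
  have hI : (Ideal.ofList (ss.map (algebraMap R S)) • ⊤ : Submodule S S) =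
      (Ideal.ofList ss).map (algebraMap R S) := by
    rw [← Ideal.map_ofList]; simp
  rw [hI, isSMulRegular_iff_right_eq_zero_of_smul] at hxreg
  have hmem : algebraMap R S y ∈ (Ideal.ofList ss).map (algebraMap R S) := by
    rw [← Submodule.Quotient.mk_eq_zero]
    apply hxreg
    rw [← Submodule.Quotient.mk_smul, Submodule.Quotient.mk_eq_zero, smul_eq_mul]
    rw [← Localization.AtPrime.map_eq_maximalIdeal] at hx
    have hle : Ideal.map (algebraMap R S) m * Ideal.span {algebraMap R S y} ≤
        (Ideal.ofList ss).map (algebraMap R S) := by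
      rw [← Set.image_singleton, ← Ideal.map_span, ← Ideal.map_mul]
      refine Ideal.map_mono ?_
      rw [Ideal.mul_le]
      intro a ha b hb
      obtain ⟨c, rfl⟩ := Ideal.mem_span_singleton'.mp hb
      rw [mul_left_comm]
      exact Ideal.mul_mem_left _ _ ((hy a).mp ha)
    exact hle (Ideal.mul_mem_mul hx (Ideal.mem_span_singleton_self _))
  obtain ⟨s, hs, hsy⟩ := (IsLocalization.algebraMap_mem_map_algebraMap_iff m.primeCompl S _ _).mp hmem
  exact hs ((hy s).mpr hsy)

end Rees

section Graded

open DirectSum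

variable {k R : Type*} [Field k] [CommRing R] [Algebra k R] (𝒜 : ℕ → Submodule k R)
  [GradedAlgebra 𝒜]

/-- Homogeneous prime avoidance: if each of finitely many primes misses some homogeneous element of
positive degree, then some homogeneous element of positive degree lies in none of them. -/
theorem exists_homogeneous_notMem_of_finset (T : Finset (Ideal R)) (hT : ∀ P ∈ T, P.IsPrime)
    (h : ∀ P ∈ T, ∃ e > 0, ∃ f ∈ 𝒜 e, f ∉ P) :
    ∃ e > 0, ∃ f ∈ 𝒜 e, ∀ P ∈ T, f ∉ P := by
  classical
  induction T using Finset.induction_on with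
  | empty => exact ⟨1, one_pos, 0, zero_mem _, by simp⟩
  | insert P T hPT ih =>
    obtain ⟨e, he, f, hf, hfT⟩ := ih (fun Q hQ => hT Q (Finset.mem_insert_of_mem hQ))
      fun Q hQ => h Q (Finset.mem_insert_of_mem hQ)
    by_cases hfP : f ∈ P
    swap
    · exact ⟨e, he, f, hf, fun Q hQ => (Finset.mem_insert.mp hQ).elim (· ▸ hfP) (hfT Q)⟩
    have hP := hT P (Finset.mem_insert_self _ _)
    let U := T.filter fun Q => ∃ d, ∃ q ∈ 𝒜 d, q ∈ Q ∧ q ∉ P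
    have hU : ∀ Q ∈ U, ∃ d, ∃ q ∈ 𝒜 d, q ∈ Q ∧ q ∉ P := fun Q hQ => (Finset.mem_filter.mp hQ).2
    have hg : ∃ e' > 0, ∃ g ∈ 𝒜 e', g ∉ P ∧ ∀ Q ∈ U, g ∈ Q := by
      clear_value U
      induction U using Finset.induction_on with
      | empty =>
        obtain ⟨e', he', g, hg, hgP⟩ := h P (Finset.mem_insert_self _ _)
        exact ⟨e', he', g, hg, hgP, by simp⟩
      | insert Q U hQU ihU =>
        obtain ⟨e', he', g, hg, hgP, hgU⟩ := ihU fun Q hQ => hU Q (Finset.mem_insert_of_mem hQ)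
        obtain ⟨d, q, hq, hqQ, hqP⟩ := hU Q (Finset.mem_insert_self _ _)
        refine ⟨e' + d, by omega, g * q, SetLike.mul_mem_graded hg hq,
          fun hmem => (hP.mem_or_mem hmem).elim hgP hqP, fun Q' hQ' => ?_⟩
        rcases Finset.mem_insert.mp hQ' with rfl | hQ'
        · exact Ideal.mul_mem_left _ _ hqQ
        · exact Ideal.mul_mem_right _ _ (hgU Q' hQ')
    obtain ⟨e', he', g, hg, hgP, hgU⟩ := hg
    have hfg : f ^ e' + g ^ e ∈ 𝒜 (e' * e) :=
      add_mem (SetLike.pow_mem_graded e' hf) (mul_comm e e' ▸ SetLike.pow_mem_graded e hg)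
    have hfgP : f ^ e' + g ^ e ∉ P := fun hmem =>
      hgP (hP.mem_of_pow_mem _ ((P.add_mem_iff_right (P.pow_mem_of_mem hfP _ he')).mp hmem))
    refine ⟨e' * e, Nat.mul_pos he' he, _, hfg, fun Q hQ hmem => ?_⟩
    rcases Finset.mem_insert.mp hQ with rfl | hQ'
    · exact hfgP hmem
    by_cases hQU : Q ∈ U
    · exact hfT Q hQ' ((hT Q hQ).mem_of_pow_mem _
        ((Q.add_mem_iff_left (Q.pow_mem_of_mem (hgU Q hQU) _ he)).mp hmem))
    · exact hQU (Finset.mem_filter.mpr ⟨hQ', _, _, hfg, hmem, hfgP⟩)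

/-- Some homogeneous component of positive degree of an element of `m` not in `P` is not in
`P`. -/
theorem exists_homogeneous_notMem_of_not_le {m P : Ideal R}
    (hm : ∀ x, x ∈ m ↔ GradedRing.proj 𝒜 0 x = 0) (h : ¬ m ≤ P) :
    ∃ e > 0, ∃ f ∈ 𝒜 e, f ∉ P := by
  classical
  by_contra! hcon
  refine h fun x hx => ?_
  rw [← DirectSum.sum_support_decompose 𝒜 x]
  refine Ideal.sum_mem _ fun i _ => ?_
  rcases Nat.eq_zero_or_pos i with rfl | hi
  · have := (hm x).mp hx
    rw [GradedRing.proj_apply] at this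
    rw [this]; exact zero_mem _
  · exact hcon i hi _ (SetLike.coe_mem _)

theorem mem_of_mem_graded_pos {m : Ideal R} (hm : ∀ x, x ∈ m ↔ GradedRing.proj 𝒜 0 x = 0)
    {e : ℕ} (he : 0 < e) {f : R} (hf : f ∈ 𝒜 e) : f ∈ m := by
  rw [hm, GradedRing.proj_apply, DirectSum.decompose_of_mem_ne 𝒜 hf he.ne']

end Graded

section GradedRegular

universe u

variable {k : Type*} {R : Type u} [Field k] [CommRing R] [Algebra k R] [IsNoetherianRing R]
  (𝒜 : ℕ → Submodule k R) [GradedAlgebra 𝒜]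

/-- If the localization at the irrelevant ideal has a regular sequence of length `d`, there is a
homogeneous weakly regular sequence of length `d` in positive degrees. -/
theorem exists_homogeneous_isWeaklyRegular {m : Ideal R} [m.IsMaximal]
    (hm : ∀ x, x ∈ m ↔ GradedRing.proj 𝒜 0 x = 0) (rs : List (Localization.AtPrime m))
    (mem : ∀ r ∈ rs, r ∈ maximalIdeal (Localization.AtPrime m))
    (reg : IsRegular (Localization.AtPrime m) rs) (j : ℕ) (hj : j ≤ rs.length) :
    ∃ ss : List R, ss.length = j ∧ (∀ s ∈ ss, ∃ e > 0, s ∈ 𝒜 e) ∧ IsWeaklyRegular R ss := by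
  induction j with
  | zero => exact ⟨[], rfl, by simp, .nil R R⟩
  | succ j ih =>
    obtain ⟨ss, hlen, hss, hreg⟩ := ih (by omega)
    have hssm : ∀ s ∈ ss, s ∈ m := fun s hs =>
      let ⟨e, he, hse⟩ := hss s hs
      mem_of_mem_graded_pos 𝒜 hm he hse
    have hnot := notMem_associatedPrimes_of_length_lt m ss hssm hreg rs mem reg (by omega)
    have hfin : (associatedPrimes R (R ⧸ Ideal.ofList ss)).Finite :=
      associatedPrimes.finite R _
    obtain ⟨e, he, f, hf, hfP⟩ := exists_homogeneous_notMem_of_finset 𝒜 hfin.toFinset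
      (fun P hP => (hfin.mem_toFinset.mp hP).isPrime) fun P hP => by
        refine exists_homogeneous_notMem_of_not_le 𝒜 hm fun hle => hnot ?_
        have hP' := hfin.mem_toFinset.mp hP
        rwa [Ideal.IsMaximal.eq_of_le inferInstance hP'.isPrime.ne_top hle]
    have hfreg : IsSMulRegular (R ⧸ Ideal.ofList ss) f := by
      by_contra hcon
      have : f ∈ ⋃ p ∈ associatedPrimes R (R ⧸ Ideal.ofList ss), (p : Set R) := by
        rw [biUnion_associatedPrimes_eq_compl_regular]; exact hcon
      simp only [Set.mem_iUnion] at this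
      obtain ⟨P, hP, hfP'⟩ := this
      exact hfP P (hfin.mem_toFinset.mpr hP) hfP'
    refine ⟨ss ++ [f], by simp [hlen], fun s hs => ?_, ?_⟩
    · rcases List.mem_append.mp hs with hs | hs
      · exact hss s hs
      · rw [List.mem_singleton.mp hs]; exact ⟨e, he, hf⟩
    · rw [isWeaklyRegular_append_iff, isWeaklyRegular_singleton_iff]
      refine ⟨hreg, ?_⟩
      have e : (R ⧸ (Ideal.ofList ss • ⊤ : Submodule R R)) ≃ₗ[R] R ⧸ Ideal.ofList ss :=
        Submodule.quotEquivOfEq _ _ (by simp)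
      exact (e.isSMulRegular_congr f).mpr hfreg

end GradedRegular

section GradedQuotient

variable {k R : Type*} [Field k] [CommRing R] [Algebra k R] (𝒜 : ℕ → Submodule k R)
  [GradedAlgebra 𝒜]

theorem isHomogeneous_ofList {ss : List R} (hss : ∀ s ∈ ss, ∃ e, s ∈ 𝒜 e) :
    (Ideal.ofList ss).IsHomogeneous 𝒜 :=
  Ideal.homogeneous_span 𝒜 _ hss

/-- A homogeneous prime is contained in the irrelevant ideal of a connected graded algebra. -/
theorem homogeneousCore_le_of_isPrime {m : Ideal R}
    (hm : ∀ x, x ∈ m ↔ GradedRing.proj 𝒜 0 x = 0)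
    (h0 : ∀ x ∈ 𝒜 0, ∃ c : k, x = algebraMap k R c) (P : Ideal R) (hP : P.IsPrime) :
    (P.homogeneousCore 𝒜).toIdeal ≤ m := by
  intro x hx
  rw [hm, GradedRing.proj_apply]
  have hx0 : (DirectSum.decompose 𝒜 x 0 : R) ∈ P :=
    Ideal.toIdeal_homogeneousCore_le 𝒜 P ((P.homogeneousCore 𝒜).isHomogeneous 0 hx)
  obtain ⟨c, hc⟩ := h0 _ (SetLike.coe_mem (DirectSum.decompose 𝒜 x 0))
  by_contra hne
  refine hP.ne_top (P.eq_top_of_isUnit_mem hx0 ?_)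
  rw [hc] at hne ⊢
  exact (isUnit_iff_ne_zero.mpr fun h => hne (by simp [h])).map (algebraMap k R)

/-- If homogeneous elements of positive degree form a system of parameters locally at the
irrelevant ideal, then the irrelevant ideal is the only prime containing them. -/
theorem eq_of_isPrime_of_ringKrullDim_quotient_eq_zero [IsNoetherianRing R] {m : Ideal R}
    [m.IsMaximal] (hm : ∀ x, x ∈ m ↔ GradedRing.proj 𝒜 0 x = 0)
    (h0 : ∀ x ∈ 𝒜 0, ∃ c : k, x = algebraMap k R c)
    (I : Ideal R) (hI : I.IsHomogeneous 𝒜)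
    (hdim : Ring.KrullDimLE 0
      (Localization.AtPrime m ⧸ I.map (algebraMap R (Localization.AtPrime m))))
    (P : Ideal R) [hP : P.IsPrime] (hIP : I ≤ P) : P = m := by
  let S := Localization.AtPrime m
  let C := (P.homogeneousCore 𝒜).toIdeal
  have hCP : C ≤ P := Ideal.toIdeal_homogeneousCore_le 𝒜 P
  have hC : C.IsPrime := Ideal.IsPrime.homogeneousCore hP
  have hCm : C ≤ m := homogeneousCore_le_of_isPrime 𝒜 hm h0 P hP
  have hIC : I ≤ C := by
    rw [← hI.toIdeal_homogeneousCore_eq_self]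
    exact Ideal.homogeneousCore_mono 𝒜 hIP
  have hdisj : Disjoint (m.primeCompl : Set R) C :=
    Set.disjoint_left.mpr fun x hx hxC => hx (hCm hxC)
  have hCS : (C.map (algebraMap R S)).IsPrime :=
    IsLocalization.isPrime_of_isPrime_disjoint m.primeCompl S C hC hdisj
  have hle : I.map (algebraMap R S) ≤ C.map (algebraMap R S) := Ideal.map_mono hIC
  have hQ : ((C.map (algebraMap R S)).map
      (Ideal.Quotient.mk (I.map (algebraMap R S)))).IsPrime :=
    Ideal.map_isPrime_of_surjective Ideal.Quotient.mk_surjective (by simpa using hle)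
  have hQmax := Ring.krullDimLE_zero_iff.mp hdim _ hQ
  have hCSmax : (C.map (algebraMap R S)).IsMaximal := by
    have := Ideal.comap_isMaximal_of_surjective (Ideal.Quotient.mk (I.map (algebraMap R S)))
      Ideal.Quotient.mk_surjective
      (K := (C.map (algebraMap R S)).map (Ideal.Quotient.mk (I.map (algebraMap R S))))
    rwa [Ideal.comap_map_of_surjective _ Ideal.Quotient.mk_surjective, ← RingHom.ker_eq_comap_bot,
      Ideal.mk_ker, sup_eq_left.mpr hle] at this
  have hCeq : C = m := by
    rw [← IsLocalization.under_map_of_isPrime_disjoint m.primeCompl S hC hdisj,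
      IsLocalRing.eq_maximalIdeal hCSmax, IsLocalization.AtPrime.under_maximalIdeal S m]
  exact (Ideal.IsMaximal.eq_of_le inferInstance hP.ne_top (hCeq ▸ hCP)).symm

/-- The quotient by a homogeneous regular sequence of maximal length is finite-dimensional. -/
theorem finite_quotient_ofList [Algebra.FiniteType k R] {m : Ideal R}
    [m.IsMaximal] (hm : ∀ x, x ∈ m ↔ GradedRing.proj 𝒜 0 x = 0)
    (h0 : ∀ x ∈ 𝒜 0, ∃ c : k, x = algebraMap k R c)
    (ss : List R) (hss : ∀ s ∈ ss, ∃ e > 0, s ∈ 𝒜 e) (reg : IsWeaklyRegular R ss)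
    (hlen : (ss.length : WithBot ℕ∞) = ringKrullDim (Localization.AtPrime m)) :
    Module.Finite k (R ⧸ Ideal.ofList ss) := by
  have : IsNoetherianRing R := Algebra.FiniteType.isNoetherianRing k R
  let S := Localization.AtPrime m
  have : IsNoetherianRing S := IsLocalization.isNoetherianRing m.primeCompl S inferInstance
  have hssm : ∀ s ∈ ss, s ∈ m := fun s hs =>
    let ⟨e, he, hse⟩ := hss s hs
    mem_of_mem_graded_pos 𝒜 hm he hse
  have hregS : IsRegular S (ss.map (algebraMap R S)) :=
    reg.isRegular_of_isLocalization_of_mem S m hssm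
  have hdim := ringKrullDim_add_length_eq_ringKrullDim_of_isRegular _ hregS
  rw [List.length_map, ← hlen, ← Ideal.map_ofList] at hdim
  have hdim0 : Ring.KrullDimLE 0 (S ⧸ (Ideal.ofList ss).map (algebraMap R S)) := by
    have aux : ∀ a : WithBot ℕ∞, a + ss.length = ss.length → a ≤ (0 : ℕ) := fun a ha =>
      (ENat.WithBot.add_le_add_natCast_right_iff (c := ss.length)).mp (by simp [ha])
    exact Ring.krullDimLE_iff.mpr (aux _ hdim)
  rw [Module.finite_iff_krullDimLE_zero, Ring.krullDimLE_zero_iff]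
  intro Q hQ
  have hPm := eq_of_isPrime_of_ringKrullDim_quotient_eq_zero 𝒜 hm h0 (Ideal.ofList ss)
    (isHomogeneous_ofList 𝒜 fun s hs => let ⟨e, _, hse⟩ := hss s hs; ⟨e, hse⟩) hdim0
    (Q.comap (Ideal.Quotient.mk _))
    (by simpa only [Ideal.mk_ker] using Ideal.ker_le_comap (Ideal.Quotient.mk (Ideal.ofList ss)))
  have : (Q.comap (Ideal.Quotient.mk (Ideal.ofList ss))).IsMaximal := hPm ▸ inferInstance
  rw [← Ideal.map_comap_of_surjective _ Ideal.Quotient.mk_surjective Q]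
  exact (Ideal.map_eq_top_or_isMaximal_of_surjective _ Ideal.Quotient.mk_surjective this).resolve_left
    (by rw [Ideal.map_comap_of_surjective _ Ideal.Quotient.mk_surjective Q]; exact hQ.ne_top)

end GradedQuotient

section FreeOverParameters

open Pointwise

variable {k R : Type*} [Field k] [CommRing R] [Algebra k R]

/-- Vectors that are linearly independent over `A` modulo a regular element `s` are linearly
independent over `A[X]`, with `X` acting as `s`. -/
theorem Polynomial.eq_zero_of_sum_eval₂_smul_eq_zero {A R ι N : Type*} [CommRing A] [CommRing R]
    [Fintype ι] [AddCommGroup N] [Module R N] (φ : A →+* R) {s : R} (hs : IsSMulRegular N s)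
    (v : ι → N)
    (hv : ∀ a : ι → A, ∑ i, φ (a i) • v i ∈ s • (⊤ : Submodule R N) → a = 0)
    (P : ι → Polynomial A) (hP : ∑ i, (P i).eval₂ φ s • v i = 0) : P = 0 := by
  have key : ∀ (n : ℕ) (P : ι → Polynomial A),
      ∑ i, (P i).eval₂ φ s • v i = 0 → ∀ i, Polynomial.X ^ n ∣ P i := by
    intro n
    induction n with
    | zero => simp
    | succ n ihn =>
      intro P hP
      have hsplit : ∀ i, (P i).eval₂ φ s = s * (P i).divX.eval₂ φ s + φ ((P i).coeff 0) := by
        intro i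
        have h := congrArg (Polynomial.eval₂ φ s) (Polynomial.divX_mul_X_add (P i))
        rw [← h, eval₂_add, eval₂_mul_X, eval₂_C, mul_comm]
      have hsum : s • ∑ i, (P i).divX.eval₂ φ s • v i + ∑ i, φ ((P i).coeff 0) • v i = 0 := by
        rw [Finset.smul_sum, ← Finset.sum_add_distrib, ← hP]
        exact Finset.sum_congr rfl fun i _ => by rw [hsplit i, add_smul, mul_smul]
      have h0 : (fun i => (P i).coeff 0) = 0 := by
        refine hv _ ?_
        rw [← neg_eq_of_add_eq_zero_right hsum]
        exact neg_mem (Submodule.smul_mem_pointwise_smul _ _ _ trivial)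
      have h0i : ∀ i, (P i).coeff 0 = 0 := congrFun h0
      intro i
      rw [← Polynomial.divX_mul_X_add (P i), h0i i, C_0, add_zero, pow_succ]
      refine mul_dvd_mul_right (ihn (fun i => (P i).divX) (hs ?_) i) _
      simpa [h0i] using hsum
  funext i
  by_contra hne
  have : Nontrivial A := Polynomial.nontrivial_iff.mp ⟨_, _, hne⟩
  have hdvd := key ((P i).natDegree + 1) P hP i
  obtain ⟨Q, hQ⟩ := hdvd
  have hQ0 : Q ≠ 0 := fun h => hne (by rw [hQ, h, mul_zero]; rfl)
  have := natDegree_X_pow_mul (n := (P i).natDegree + 1) hQ0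
  rw [← hQ] at this
  omega

theorem MvPolynomial.aeval_cons_eq_eval₂_finSuccEquiv {d : ℕ} (s : R) (θ : Fin d → R)
    (p : MvPolynomial (Fin (d + 1)) k) :
    aeval (Fin.cons s θ : Fin (d + 1) → R) p =
      (finSuccEquiv k d p).eval₂ (aeval θ : MvPolynomial (Fin d) k →ₐ[k] R).toRingHom s := by
  induction p using MvPolynomial.induction_on with
  | C a => simp [finSuccEquiv_apply]
  | add p q hp hq => simp [hp, hq, Polynomial.eval₂_add]
  | mul_X p i hp =>
    rw [map_mul, hp, map_mul, Polynomial.eval₂_mul]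
    refine congrArg _ ?_
    refine Fin.cases ?_ (fun j => ?_) i
    · simp [finSuccEquiv_X_zero]
    · simp [finSuccEquiv_X_succ]

/-- Vectors that are linearly independent modulo a weakly regular sequence are linearly
independent over the polynomial ring acting through that sequence. -/
theorem eq_zero_of_sum_aeval_smul_eq_zero {ι : Type*} [Fintype ι] (d : ℕ) (θ : Fin d → R)
    (N : Type*) [AddCommGroup N] [Module R N] (reg : IsWeaklyRegular N (List.ofFn θ))
    (v : ι → N)
    (hv : ∀ c : ι → k, ∑ i, algebraMap k R (c i) • v i ∈
      (Ideal.ofList (List.ofFn θ) • ⊤ : Submodule R N) → c = 0)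
    (p : ι → MvPolynomial (Fin d) k) (hp : ∑ i, MvPolynomial.aeval θ (p i) • v i = 0) :
    p = 0 := by
  induction d generalizing N with
  | zero =>
    have hC : ∀ i, p i = MvPolynomial.C (MvPolynomial.constantCoeff (p i)) := fun i =>
      MvPolynomial.eq_C_of_isEmpty _
    have := hv (fun i => MvPolynomial.constantCoeff (p i)) (by
      convert! zero_mem (Ideal.ofList (List.ofFn θ) • ⊤ : Submodule R N)
      rw [← hp]
      refine Finset.sum_congr rfl fun i _ => ?_
      conv_rhs => rw [hC i]
      simp)
    funext i
    rw [hC i, congrFun this i]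
    simp
  | succ d ih =>
    obtain ⟨s, θ, rfl⟩ : ∃ s θ', θ = Fin.cons s θ' := ⟨θ 0, Fin.tail θ, (Fin.cons_self_tail θ).symm⟩
    rw [List.ofFn_succ] at reg hv
    simp only [Fin.cons_zero, Fin.cons_succ] at reg hv
    obtain ⟨hs, hreg⟩ := (isWeaklyRegular_cons_iff N s _).mp reg
    let w : ι → QuotSMulTop s N := fun i => Submodule.Quotient.mk (v i)
    have hmk : ∀ a : ι → R, ∑ i, a i • w i = Submodule.Quotient.mk (∑ i, a i • v i) :=
      fun a => by simp [w, ← Submodule.mkQ_apply]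
    have hw : ∀ c : ι → k, ∑ i, algebraMap k R (c i) • w i ∈
        (Ideal.ofList (List.ofFn θ) • ⊤ : Submodule R (QuotSMulTop s N)) → c = 0 := by
      intro c hc
      refine hv c ?_
      rw [hmk fun i => algebraMap k R (c i), ← Submodule.Quotient.mk_eq_zero] at hc
      rw [← Submodule.Quotient.mk_eq_zero]
      apply (Submodule.quotOfListConsSMulTopEquivQuotSMulTopInner N s (List.ofFn θ)).injective
      rw [map_zero]
      exact hc
    have hp0 : (fun i => MvPolynomial.finSuccEquiv k d (p i)) = 0 := by
      refine Polynomial.eq_zero_of_sum_eval₂_smul_eq_zero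
        (MvPolynomial.aeval θ : MvPolynomial (Fin d) k →ₐ[k] R).toRingHom hs v (fun a ha => ?_) _
        (by simpa only [MvPolynomial.aeval_cons_eq_eval₂_finSuccEquiv] using hp)
      refine ih θ (QuotSMulTop s N) hreg w hw a ?_
      rw [hmk]
      exact (Submodule.Quotient.mk_eq_zero _).mpr ha
    funext i
    apply (MvPolynomial.finSuccEquiv k d).injective
    rw [Pi.zero_apply, map_zero]
    exact congrFun hp0 i

end FreeOverParameters

section GradedCM

variable {k : Type*} [Field k]

/-- A graded version of Nakayama's lemma. -/
theorem eq_top_of_graded_span {R ι : Type*} [CommRing R] [Algebra k R] (𝒜 : ℕ → Submodule k R)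
    [GradedAlgebra 𝒜] {d : ℕ} (θ : Fin d → R) (hθ : ∀ j, ∃ e > 0, θ j ∈ 𝒜 e)
    (v : ι → R) (hv : ∀ i, ∃ e, v i ∈ 𝒜 e)
    (hspan : ∀ x, ∃ y ∈ Submodule.span k (Set.range v), x - y ∈ Ideal.span (Set.range θ))
    (W : Submodule k R) (hvW : ∀ i, v i ∈ W) (hmul : ∀ j, ∀ x ∈ W, θ j * x ∈ W) : W = ⊤ := by
  classical
  have hn : ∀ n, ∀ x ∈ 𝒜 n, x ∈ W := by
    intro n
    induction n using Nat.strong_induction_on with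
    | _ n ih =>
      intro x hx
      obtain ⟨y, hy, hz⟩ := hspan x
      have hyW : GradedRing.proj 𝒜 n y ∈ W := by
        clear hz
        induction hy using Submodule.span_induction with
        | mem y hy =>
          obtain ⟨i, rfl⟩ := hy
          obtain ⟨e, he⟩ := hv i
          rw [GradedRing.proj_apply]
          by_cases hen : e = n
          · subst hen; rw [DirectSum.decompose_of_mem_same 𝒜 he]; exact hvW i
          · rw [DirectSum.decompose_of_mem_ne 𝒜 he hen]; exact zero_mem _
        | zero => simp
        | add y z _ _ hy hz => rw [map_add]; exact add_mem hy hz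
        | smul c y _ hy =>
          rw [GradedRing.proj_apply] at hy ⊢
          rw [DirectSum.decompose_smul, DirectSum.smul_apply, Submodule.coe_smul]
          exact W.smul_mem c hy
      have hzW : GradedRing.proj 𝒜 n (x - y) ∈ W := by
        obtain ⟨r, hr⟩ := (Ideal.mem_span_range_iff_exists_fun).mp hz
        rw [← hr, map_sum]
        refine sum_mem fun j _ => ?_
        obtain ⟨e, he, hje⟩ := hθ j
        rw [GradedRing.proj_apply, mul_comm]
        by_cases hen : e ≤ n
        · rw [DirectSum.coe_decompose_mul_of_left_mem_of_le 𝒜 hje hen]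
          exact hmul j _ (ih (n - e) (by omega) _ (SetLike.coe_mem _))
        · rw [DirectSum.coe_decompose_mul_of_left_mem_of_not_le 𝒜 hje hen]
          exact zero_mem _
      have hx' : x = GradedRing.proj 𝒜 n (x - y) + GradedRing.proj 𝒜 n y := by
        rw [← map_add, sub_add_cancel, GradedRing.proj_apply, DirectSum.decompose_of_mem_same 𝒜 hx]
      rw [hx']
      exact add_mem hzW hyW
  refine Submodule.eq_top_iff'.mpr fun x => ?_
  rw [← DirectSum.sum_support_decompose 𝒜 x]
  exact sum_mem fun i _ => hn i _ (SetLike.coe_mem _)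

/-- A finite-dimensional quotient of a graded algebra has a basis of images of homogeneous
elements. -/
theorem exists_homogeneous_lifts {R : Type*} [CommRing R] [Algebra k R] (𝒜 : ℕ → Submodule k R)
    [GradedAlgebra 𝒜] (I : Ideal R) [Module.Finite k (R ⧸ I)] :
    ∃ (q : ℕ) (v : Fin q → R), (∀ i, ∃ e, v i ∈ 𝒜 e) ∧
      (∀ x, ∃ y ∈ Submodule.span k (Set.range v), x - y ∈ I) ∧
      ∀ c : Fin q → k, ∑ i, algebraMap k R (c i) • v i ∈ I → c = 0 := by
  classical
  let π : R →ₗ[k] R ⧸ I := (Ideal.Quotient.mkₐ k I).toLinearMap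
  have hπ : ∀ x, π x = 0 ↔ x ∈ I := fun x => Ideal.Quotient.eq_zero_iff_mem
  let s : Set (R ⧸ I) := {z | ∃ x, (∃ e, x ∈ 𝒜 e) ∧ π x = z}
  have hs : Submodule.span k s = ⊤ := by
    refine Submodule.eq_top_iff'.mpr fun z => ?_
    obtain ⟨x, rfl⟩ := Ideal.Quotient.mk_surjective z
    change π x ∈ _
    rw [← DirectSum.sum_support_decompose 𝒜 x, map_sum]
    exact sum_mem fun i _ => Submodule.subset_span ⟨_, ⟨i, SetLike.coe_mem _⟩, rfl⟩
  obtain ⟨b, hbs, hb, hli⟩ := exists_linearIndependent k s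
  have hbfin : Finite b := hli.finite
  obtain ⟨q, ⟨e⟩⟩ := Finite.exists_equiv_fin b
  choose l hl hlπ using fun i : Fin q => hbs (e.symm i).2
  have hli' : LinearIndependent k (π ∘ l) := by
    have : π ∘ l = (Subtype.val : b → R ⧸ I) ∘ e.symm := funext hlπ
    rw [this]
    exact hli.comp _ e.symm.injective
  refine ⟨q, l, hl, fun x => ?_, fun c hc => ?_⟩
  · have hx : π x ∈ Submodule.map π (Submodule.span k (Set.range l)) := by
      rw [Submodule.map_span, ← Set.range_comp]
      have : Set.range (π ∘ l) = b := by
        rw [show π ∘ l = (Subtype.val : b → R ⧸ I) ∘ e.symm from funext hlπ,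
          e.symm.surjective.range_comp, Subtype.range_coe]
      rw [this, hb, hs]
      trivial
    obtain ⟨y, hy, hyx⟩ := hx
    exact ⟨y, hy, (hπ _).mp (by rw [map_sub, hyx, sub_self])⟩
  · funext i
    refine Fintype.linearIndependent_iff.mp hli' c ?_ i
    rw [← (hπ _).mpr hc, map_sum]
    refine Finset.sum_congr rfl fun i _ => ?_
    rw [algebraMap_smul, map_smul]
    rfl

/-- A connected graded algebra whose localization at the irrelevant ideal is Cohen–Macaulay is
Cohen–Macaulay. -/
theorem isCMRing_of_graded {R : Type*} [CommRing R] [Algebra k R] [Algebra.FiniteType k R]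
    (𝒜 : ℕ → Submodule k R) [GradedAlgebra 𝒜] {m : Ideal R} [m.IsMaximal]
    (hm : ∀ x, x ∈ m ↔ GradedRing.proj 𝒜 0 x = 0)
    (h0 : ∀ x ∈ 𝒜 0, ∃ c : k, x = algebraMap k R c)
    (h : IsCMLocalRing (Localization.AtPrime m)) : IsCMRing R := by
  have : IsNoetherianRing R := Algebra.FiniteType.isNoetherianRing k R
  obtain ⟨_, _, rs, hrs, hreg, hlen⟩ := h
  obtain ⟨ss, hsslen, hss, hssreg⟩ := exists_homogeneous_isWeaklyRegular 𝒜 hm rs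
    (fun r hr => (IsLocalRing.mem_maximalIdeal r).mpr (hrs r hr)) hreg rs.length le_rfl
  have hfin := finite_quotient_ofList 𝒜 hm h0 ss hss hssreg (by rw [hsslen]; exact hlen)
  obtain ⟨q, v, hv, hspan, hli⟩ := exists_homogeneous_lifts 𝒜 (Ideal.ofList ss)
  let θ : Fin ss.length → R := ss.get
  have hθ : List.ofFn θ = ss := List.ofFn_get ss
  let := (MvPolynomial.aeval θ : MvPolynomial (Fin ss.length) k →ₐ[k] R).toRingHom.toAlgebra
  have hsmul : ∀ (p : MvPolynomial (Fin ss.length) k) (x : R),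
      p • x = MvPolynomial.aeval θ p * x := fun p x => Algebra.smul_def p x
  have hvli : LinearIndependent (MvPolynomial (Fin ss.length) k) v := by
    rw [Fintype.linearIndependent_iff]
    intro p hp
    refine congrFun (eq_zero_of_sum_aeval_smul_eq_zero (k := k) ss.length θ R
      (by rwa [hθ]) v (fun c hc => hli c ?_) p (by simpa only [hsmul, smul_eq_mul] using hp))
    rw [hθ] at hc
    simpa using hc
  have hvspan : ⊤ ≤ Submodule.span (MvPolynomial (Fin ss.length) k) (Set.range v) := by
    have hC : ∀ (c : k) (x : R), c • x = (MvPolynomial.C c : MvPolynomial (Fin ss.length) k) • x :=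
      fun c x => by rw [hsmul, MvPolynomial.aeval_C, Algebra.smul_def]
    let W : Submodule k R :=
      { (Submodule.span (MvPolynomial (Fin ss.length) k) (Set.range v)).toAddSubmonoid with
        smul_mem' := fun c x hx => by
          rw [hC]
          exact Submodule.smul_mem _ _ hx }
    have hW : W = ⊤ := by
      refine eq_top_of_graded_span 𝒜 θ (fun j => hss _ (List.get_mem ss j)) v hv ?_ W
        (fun i => Submodule.subset_span ⟨i, rfl⟩) fun j x hx => ?_
      · have : Set.range θ = {s | s ∈ ss} := Set.range_list_get ss
        rw [this]
        exact hspan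
      · have hX : θ j * x = (MvPolynomial.X j : MvPolynomial (Fin ss.length) k) • x := by
          rw [hsmul, MvPolynomial.aeval_X]
        rw [hX]
        exact Submodule.smul_mem (Submodule.span _ (Set.range v)) _ hx
    intro x _
    exact (hW ▸ Submodule.mem_top : x ∈ W)
  let b := Module.Basis.mk hvli hvspan
  have := Module.Finite.of_basis b
  have := Module.Free.of_basis b
  exact IsCMRing.of_finite_flat (MvPolynomial.isCMRing_of_field k ss.length)

end GradedCM

section Weight

/-- **Gordan's theorem**: finitely many rational vectors without a nontrivial nonnegative linear
relation lie in an open half-space. -/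
theorem exists_dual_pos_of_forall_nonneg_relation {V : Type*} [AddCommGroup V] [Module ℚ V] (q : ℕ)
    (v : Fin q → V)
    (hv : ∀ c : Fin q → ℚ, (∀ i, 0 ≤ c i) → ∑ i, c i • v i = 0 → c = 0) :
    ∃ f : V →ₗ[ℚ] ℚ, ∀ i, 0 < f (v i) := by
  induction q generalizing V with
  | zero => exact ⟨0, fun i => i.elim0⟩
  | succ q ih =>
    have hcons : ∀ (t : ℚ) (c : Fin q → ℚ), 0 ≤ t → (∀ i, 0 ≤ c i) →
        t • v 0 + ∑ i, c i • v i.succ = 0 → t = 0 ∧ c = 0 := by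
      intro t c ht hc hsum
      have h := hv (Fin.cons t c) (Fin.cases ht hc) (by simpa [Fin.sum_univ_succ] using hsum)
      exact ⟨congrFun h 0, funext fun i => congrFun h i.succ⟩
    have hv0 : v 0 ≠ 0 := fun h =>
      one_ne_zero (hcons 1 0 zero_le_one (fun _ => le_rfl) (by simp [h])).1
    by_cases hquot : ∀ c : Fin q → ℚ, (∀ i, 0 ≤ c i) →
        ∑ i, c i • (ℚ ∙ v 0).mkQ (v i.succ) = 0 → c = 0
    · obtain ⟨f, hf⟩ := ih _ hquot
      obtain ⟨φ, hφ⟩ : ∃ φ : Module.Dual ℚ V, φ (v 0) ≠ 0 := by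
        by_contra! hcon
        exact hv0 ((Module.forall_dual_apply_eq_zero_iff ℚ _).mp hcon)
      let g : V →ₗ[ℚ] ℚ := (φ (v 0))⁻¹ • φ
      have hg : g (v 0) = 1 := by simp [g, hφ]
      let F : V →ₗ[ℚ] ℚ := f ∘ₗ (ℚ ∙ v 0).mkQ
      have hF0 : F (v 0) = 0 := by
        have : (ℚ ∙ v 0).mkQ (v 0) = 0 := by
          rw [Submodule.mkQ_apply, Submodule.Quotient.mk_eq_zero]
          exact Submodule.mem_span_singleton_self _
        rw [LinearMap.comp_apply, this, map_zero]
      have hF : ∀ i : Fin q, 0 < F (v i.succ) := hf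
      let K : ℚ := ∑ i : Fin q, (1 + |g (v i.succ)|) / F (v i.succ)
      refine ⟨g + K • F, Fin.cases ?_ fun i => ?_⟩
      · simp [hg, hF0]
      · have hK : (1 + |g (v i.succ)|) / F (v i.succ) ≤ K :=
          Finset.single_le_sum (f := fun i : Fin q => (1 + |g (v i.succ)|) / F (v i.succ))
            (fun j _ => div_nonneg (by positivity) (hF j).le) (Finset.mem_univ i)
        rw [div_le_iff₀ (hF i)] at hK
        have := neg_abs_le (g (v i.succ))
        simp only [LinearMap.add_apply, LinearMap.smul_apply, smul_eq_mul]
        linarith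
    · push Not at hquot
      obtain ⟨c, hc, hsum, hne⟩ := hquot
      obtain ⟨f, hf⟩ := ih (fun i => v i.succ) fun c hc hsum =>
        (hcons 0 c le_rfl hc (by simpa using hsum)).2
      have hmem : ∑ i, c i • v i.succ ∈ ℚ ∙ v 0 := by
        rw [← Submodule.Quotient.mk_eq_zero, ← Submodule.mkQ_apply, ← hsum]
        simp
      obtain ⟨t, ht⟩ := Submodule.mem_span_singleton.mp hmem
      have htpos : 0 < t := by
        by_contra! hle
        exact hne (hcons (-t) c (by linarith) hc (by rw [← ht]; simp)).2
      refine ⟨f, Fin.cases ?_ hf⟩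
      obtain ⟨j, hj⟩ := Function.ne_iff.mp hne
      have hpos : 0 < t * f (v 0) := by
        rw [← smul_eq_mul, ← map_smul, ht, map_sum]
        refine Finset.sum_pos' (fun i _ => ?_) ⟨j, Finset.mem_univ _, ?_⟩
        · rw [map_smul]; exact mul_nonneg (hc i) (hf i).le
        · rw [map_smul]; exact mul_pos ((hc j).lt_of_ne' hj) (hf j)
      exact pos_of_mul_pos_right hpos htpos.le

/-- Finitely many nonnegative rationals have a common denominator. -/
theorem exists_nat_mul_eq_natCast {ι : Type*} [Fintype ι] (c : ι → ℚ) (hc : ∀ i, 0 ≤ c i) :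
    ∃ (D : ℕ) (a : ι → ℕ), 0 < D ∧ ∀ i, D * c i = a i := by
  classical
  refine ⟨∏ i, (c i).den, fun i => (c i).num.toNat * ∏ j ∈ Finset.univ.erase i, (c j).den,
    Finset.prod_pos fun i _ => (c i).den_pos, fun i => ?_⟩
  rw [← Finset.mul_prod_erase _ _ (Finset.mem_univ i)]
  have hnum : (((c i).num.toNat : ℕ) : ℚ) = (c i).num := by
    exact_mod_cast Int.toNat_of_nonneg (Rat.num_nonneg.mpr (hc i))
  have hden : ((c i).den : ℚ) * c i = (c i).num := Rat.den_mul_eq_num (c i)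
  push_cast
  rw [hnum, ← hden]
  ring

/-- A positive affine semigroup has a weight function to `ℕ` vanishing only at zero. -/
theorem exists_weight_of_positive {n : ℕ} (M : AddSubmonoid (Fin n → ℤ)) (hM : M.FG)
    (hpos : ∀ a ∈ M, -a ∈ M → a = 0) : ∃ w : M →+ ℕ, ∀ a, w a = 0 → a = 0 := by
  classical
  obtain ⟨S, hS⟩ := hM
  let T := S.filter (· ≠ 0)
  let e := T.equivFin
  let g : Fin T.card → (Fin n → ℤ) := fun i => (e.symm i : Fin n → ℤ)
  have hgM : ∀ i, g i ∈ M := fun i => hS ▸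
    AddSubmonoid.subset_closure (Finset.mem_filter.mp (e.symm i).2).1
  have hg0 : ∀ i, g i ≠ 0 := fun i => (Finset.mem_filter.mp (e.symm i).2).2
  let ρ : (Fin n → ℤ) →+ (Fin n → ℚ) := (Int.castAddHom ℚ).compLeft (Fin n)
  have hρ : Function.Injective ρ := fun a b hab => funext fun i =>
    Int.cast_injective (α := ℚ) (congrFun hab i)
  have hrel : ∀ c : Fin T.card → ℚ, (∀ i, 0 ≤ c i) → ∑ i, c i • ρ (g i) = 0 → c = 0 := by
    intro c hc hsum
    obtain ⟨D, a, hD, ha⟩ := exists_nat_mul_eq_natCast c hc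
    have hsum' : ∑ i, a i • g i = 0 := by
      apply hρ
      rw [map_zero, map_sum, ← smul_zero (D : ℚ), ← hsum, Finset.smul_sum]
      refine Finset.sum_congr rfl fun i _ => ?_
      rw [smul_smul, ha, map_nsmul, Nat.cast_smul_eq_nsmul]
    funext j
    by_contra hj
    have haj : a j ≠ 0 := fun h0 => by
      have := ha j
      rw [h0, Nat.cast_zero] at this
      exact hj ((mul_eq_zero.mp this).resolve_left (by positivity))
    obtain ⟨b, hb⟩ := Nat.exists_eq_succ_of_ne_zero haj
    refine hg0 j (hpos _ (hgM j) ?_)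
    rw [← Finset.add_sum_erase _ _ (Finset.mem_univ j), hb, Nat.succ_eq_add_one, succ_nsmul',
      add_assoc] at hsum'
    rw [neg_eq_of_add_eq_zero_right hsum']
    exact add_mem (nsmul_mem (hgM j) _) (sum_mem fun i _ => nsmul_mem (hgM i) _)
  obtain ⟨f, hf⟩ := exists_dual_pos_of_forall_nonneg_relation _ _ hrel
  obtain ⟨D, a, hD, ha⟩ := exists_nat_mul_eq_natCast (fun i => f (ρ (g i))) fun i => (hf i).le
  have key : ∀ x ∈ M, ∃ m : ℕ, D * f (ρ x) = m ∧ (m = 0 → x = 0) := by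
    intro x hx
    rw [← hS] at hx
    induction hx using AddSubmonoid.closure_induction with
    | mem x hx =>
      by_cases hx0 : x = 0
      · exact ⟨0, by simp [hx0], fun _ => hx0⟩
      · obtain ⟨i, rfl⟩ : ∃ i, g i = x :=
          ⟨e ⟨x, Finset.mem_filter.mpr ⟨hx, hx0⟩⟩, by simp [g]⟩
        refine ⟨a i, ha i, fun h0 => ?_⟩
        have hai := ha i
        rw [h0, Nat.cast_zero] at hai
        exact absurd hai (mul_pos (by exact_mod_cast hD) (hf i)).ne'
    | zero => exact ⟨0, by simp, fun _ => rfl⟩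
    | add x y _ _ hx hy =>
      obtain ⟨p, hp, hp0⟩ := hx
      obtain ⟨q, hq, hq0⟩ := hy
      refine ⟨p + q, by rw [map_add, map_add, mul_add, hp, hq, Nat.cast_add], fun h0 => ?_⟩
      rw [hp0 (by omega), hq0 (by omega), add_zero]
  choose! m hm hm0 using key
  refine ⟨⟨⟨fun x => m x, ?_⟩, fun x y => ?_⟩, fun x hx => Subtype.ext (hm0 x x.2 hx)⟩
  · have := hm 0 (zero_mem M)
    rw [map_zero, map_zero, mul_zero] at this
    exact_mod_cast this.symm
  · have := hm _ (add_mem x.2 y.2)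
    rw [map_add, map_add, mul_add, hm x x.2, hm y y.2] at this
    exact_mod_cast this.symm

end Weight

section SemigroupRing

variable (k : Type*) [Field k] {n : ℕ} (M : AddSubmonoid (Fin n → ℤ))

/-- For a weight function vanishing only at zero, `m` is the irrelevant ideal. -/
theorem mem_facePrime_bot_iff (w : M →+ ℕ) (hw : ∀ a, w a = 0 → a = 0)
    (hmax : (facePrime k M ⊥).IsMaximal) (x : AddMonoidAlgebra k M) :
    x ∈ facePrime k M ⊥ ↔ GradedRing.proj (AddMonoidAlgebra.gradeBy k w) 0 x = 0 := by
  have hle : facePrime k M ⊥ ≤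
      (HomogeneousIdeal.irrelevant (AddMonoidAlgebra.gradeBy k w)).toIdeal := by
    refine Ideal.span_le.mpr ?_
    rintro _ ⟨a, ha, rfl⟩
    refine HomogeneousIdeal.mem_irrelevant_of_mem (AddMonoidAlgebra.gradeBy k w)
      (Nat.pos_of_ne_zero fun h => ha ?_) (AddMonoidAlgebra.single_mem_gradeBy w a 1)
    rw [hw a h]
    exact AddSubmonoid.zero_mem _
  have hne : (HomogeneousIdeal.irrelevant (AddMonoidAlgebra.gradeBy k w)).toIdeal ≠ ⊤ := by
    rw [Ideal.ne_top_iff_one]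
    intro h
    have h1 := (HomogeneousIdeal.mem_irrelevant_iff (AddMonoidAlgebra.gradeBy k w) 1).mp h
    rw [GradedRing.proj_apply, DirectSum.decompose_of_mem_same _ SetLike.GradedOne.one_mem] at h1
    exact one_ne_zero h1
  rw [hmax.eq_of_le hne hle]
  exact HomogeneousIdeal.mem_irrelevant_iff (AddMonoidAlgebra.gradeBy k w) x

theorem exists_eq_algebraMap_of_mem_gradeBy_zero (w : M →+ ℕ) (hw : ∀ a, w a = 0 → a = 0)
    (x : AddMonoidAlgebra k M) (hx : x ∈ AddMonoidAlgebra.gradeBy k w 0) :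
    ∃ c : k, x = algebraMap k (AddMonoidAlgebra k M) c := by
  have hx0 : x ∈ AddMonoidAlgebra.grade k (0 : M) := fun a ha => hw a (hx a ha)
  obtain ⟨c, hc⟩ := (AddMonoidAlgebra.mem_grade_iff' k 0 x).mp hx0
  exact ⟨c, hc.symm⟩

end SemigroupRing

/-- For a positive affine semigroup `M`, the ring `k[M]` is Cohen–Macaulay if and only if its
localization at the maximal ideal `m` of monomials of nonzero degree is a Cohen–Macaulay local
ring. -/
theorem cm_iff_localization_cm
    (k : Type*) [Field k] (n : ℕ) (hn : 1 ≤ n)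
    (M : AddSubmonoid (Fin n → ℤ)) (hM : M.FG)
    (hpos : ∀ a ∈ M, -a ∈ M → a = 0)
    (hmax : (facePrime k M ⊥).IsMaximal) :
    IsCMRing (AddMonoidAlgebra k M) ↔
      IsCMLocalRing
        (Localization (@Ideal.primeCompl _ _ (facePrime k M ⊥) hmax.isPrime)) := by
  refine ⟨fun h => h.2 _ hmax.isPrime, fun h => ?_⟩
  obtain ⟨w, hw⟩ := exists_weight_of_positive M hM hpos
  have : AddMonoid.FG M := (AddMonoid.fg_iff_addSubmonoid_fg M).mpr hM
  exact isCMRing_of_graded (AddMonoidAlgebra.gradeBy k w) (mem_facePrime_bot_iff k M w hw hmax)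
    (exists_eq_algebraMap_of_mem_gradeBy_zero k M w hw) h
end
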